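/- arXiv:2506.16271 — 6 statements merged into one kernel-verified Lean document; each statement's English description precedes it below -/
import Mathlib

section
/- Let q ≥ 5 be an odd prime power and F_q the finite field with q elements. Then there exists a subset A of F_q \ {0} with |A| = (q−3)/2 such that: 1 ∉ A and −1 ∉ A; for every a ∈ A, −a ∉ A; A ∩ A⁻¹ = ∅, where A⁻¹ := {a⁻¹ : a ∈ A}; and {1, −1} ∪ A ∪ A⁻¹ = F_q \ {0}. -/
/-- A field with `2 ≠ 0` has a set containing exactly one of `y`, `-y` for each `y ≠ 0`,
and not containing `0`. -/
theorem exists_half_system {F : Type*} [Field F] (h2 : (2 : F) ≠ 0) :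
    ∃ P : F → Prop, (∀ y, P y → ¬ P (-y)) ∧ ∀ y, y ≠ 0 → P y ∨ P (-y) := by
  refine ⟨fun y => WellOrderingRel y (-y), fun y hy hy' => ?_, fun y hy => ?_⟩
  · beta_reduce at hy hy'
    rw [neg_neg] at hy'
    exact asymm hy hy'
  · rcases trichotomous_of WellOrderingRel y (-y) with h | h | h
    · exact Or.inl h
    · refine absurd ?_ (mul_ne_zero h2 hy)
      linear_combination h
    · exact Or.inr (by simpa only [neg_neg] using h)

/-- For every odd prime power `q ≥ 5` there is a set `A ⊆ F_q \ {0}` of size `(q-3)/2`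
with `1, -1 ∉ A`, `A ∩ (-A) = ∅`, `A ∩ A⁻¹ = ∅` and `{1,-1} ∪ A ∪ A⁻¹ = F_q \ {0}`. -/
theorem statement0 (q : ℕ) (hq : IsPrimePow q) (hq5 : 5 ≤ q) (hqodd : Odd q)
    (F : Type) [Field F] [Fintype F] (hF : Fintype.card F = q) :
    ∃ A : Finset F,
      A.card = (q - 3) / 2 ∧
      (0 : F) ∉ A ∧
      (1 : F) ∉ A ∧
      (-1 : F) ∉ A ∧
      (∀ a ∈ A, -a ∉ A) ∧
      (∀ a ∈ A, a⁻¹ ∉ A) ∧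
      ({(1 : F), -1} : Set F) ∪ (A : Set F) ∪ (fun a : F => a⁻¹) '' (A : Set F)
        = {x : F | x ≠ 0} := by
  classical
  have h2 : (2 : F) ≠ 0 := by
    refine Ring.two_ne_zero fun h => ?_
    have := FiniteField.even_card_of_char_two h
    rw [hF] at this
    have := Nat.odd_iff.1 hqodd
    omega
  obtain ⟨P, hP, hP'⟩ := exists_half_system h2
  have hP0 : ¬ P 0 := fun h => hP 0 h (by rwa [neg_zero])
  set A : Finset F := Finset.univ.filter fun x => P (x - x⁻¹) with hA
  have mem : ∀ x, x ∈ A ↔ P (x - x⁻¹) := fun x => by simp [hA]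
  have h0 : (0 : F) ∉ A := by simpa [mem] using hP0
  have h1 : (1 : F) ∉ A := by simpa [mem] using hP0
  have hm1 : (-1 : F) ∉ A := by simpa [mem, inv_neg] using hP0
  have hneg : ∀ a ∈ A, -a ∉ A := fun a ha h => by
    rw [mem] at ha h
    refine hP _ ha ?_
    rwa [inv_neg, ← neg_sub'] at h
  have hinv : ∀ a ∈ A, a⁻¹ ∉ A := fun a ha h => by
    rw [mem] at ha h
    refine hP _ ha ?_
    rwa [inv_inv, ← neg_sub] at h
  have hcover : ∀ x : F, x ≠ 0 → x ≠ 1 → x ≠ -1 → x ∈ A ∨ x⁻¹ ∈ A := fun x hx hx1 hxm1 => by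
    rw [mem, mem, inv_inv, ← neg_sub x]
    refine hP' _ fun h => ?_
    have hsq : x * x = 1 := by
      rw [sub_eq_zero] at h
      nth_rewrite 2 [h]
      exact mul_inv_cancel₀ hx
    rcases mul_self_eq_one_iff.1 hsq with h | h
    · exact hx1 h
    · exact hxm1 h
  refine ⟨A, ?_, h0, h1, hm1, hneg, hinv, ?_⟩
  · have hdisj : Disjoint A (A.image (·⁻¹)) := by
      rw [Finset.disjoint_left]
      intro a ha h
      obtain ⟨b, hb, rfl⟩ := Finset.mem_image.1 h
      exact hinv b hb ha
    have hcompl : A ∪ A.image (·⁻¹) = ({0, 1, -1} : Finset F)ᶜ := by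
      ext x
      simp only [Finset.mem_union, Finset.mem_image, Finset.mem_compl, Finset.mem_insert,
        Finset.mem_singleton, not_or]
      constructor
      · rintro (hx | ⟨b, hb, rfl⟩)
        · exact ⟨ne_of_mem_of_not_mem hx h0, ne_of_mem_of_not_mem hx h1,
            ne_of_mem_of_not_mem hx hm1⟩
        · refine ⟨inv_ne_zero (ne_of_mem_of_not_mem hb h0), fun h => h1 ?_, fun h => hm1 ?_⟩
          · rwa [← inv_eq_one.1 h]
          · rwa [inv_eq_iff_eq_inv.1 h, inv_neg, inv_one] at hb
      · rintro ⟨hx, hx1, hxm1⟩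
        exact (hcover x hx hx1 hxm1).imp_right fun h => ⟨_, h, inv_inv x⟩
    have h1m1 : (1 : F) ≠ -1 := fun h => h2 (by linear_combination h)
    have hthree : ({0, 1, -1} : Finset F).card = 3 :=
      Finset.card_eq_three.2 ⟨0, 1, -1, zero_ne_one, by simp, h1m1, rfl⟩
    have hcard := congrArg Finset.card hcompl
    rw [Finset.card_union_of_disjoint hdisj, Finset.card_image_of_injective _ inv_injective,
      Finset.card_compl, hthree, hF] at hcard
    omega
  · ext x
    simp only [Set.mem_union, Set.mem_insert_iff, Set.mem_singleton_iff, Finset.mem_coe,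
      Set.mem_image, Set.mem_ofPred_eq]
    constructor
    · rintro (((rfl | rfl) | hx) | ⟨b, hb, rfl⟩)
      · exact one_ne_zero
      · exact neg_ne_zero.2 one_ne_zero
      · exact ne_of_mem_of_not_mem hx h0
      · exact inv_ne_zero (ne_of_mem_of_not_mem hb h0)
    · intro hx
      by_cases hx1 : x = 1
      · exact Or.inl (Or.inl (Or.inl hx1))
      by_cases hxm1 : x = -1
      · exact Or.inl (Or.inl (Or.inr hxm1))
      exact (hcover x hx hx1 hxm1).imp Or.inr fun h => ⟨_, h, inv_inv x⟩
end

section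
/- Let q be a prime power, let α, η ∈ F_{q^2} \ {0} with η^{q+1} = 1. Then the image of Σ_α under the collineation τ_η equals Σ_β for every β ∈ F_{q^2} \ {0} with β^{q+1} = (α^{q+1})^{−1}; in particular τ_η(Σ_α) = Σ_{α^{−q}}. -/
open Projectivization Classical

noncomputable section

abbrev Pt (F : Type) [Field F] := Projectivization F (Fin 4 → F)

variable (q : ℕ) (F : Type) [Field F]

/-- The line `t₁ = {(x₁, x₂, 0, 0)}` of `PG(3, q²)`. -/
def t1 : Set (Pt F) := {P | P.rep 2 = 0 ∧ P.rep 3 = 0}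

/-- The line `t₂ = {(0, 0, x₃, x₄)}` of `PG(3, q²)`. -/
def t2 : Set (Pt F) := {P | P.rep 0 = 0 ∧ P.rep 1 = 0}

/-- The line `r_{U₁} = {(x₁, 0, x₃, 0)}` of `PG(3, q²)`. -/
def rU1 : Set (Pt F) := {P | P.rep 1 = 0 ∧ P.rep 3 = 0}

/-- The Baer subgeometry `Σ_α = {(x, y, α xᑫ, α yᑫ)}`. -/
def SigmaSet (α : F) : Set (Pt F) :=
  {P | ∃ (x y : F) (h : ![x, y, α * x ^ q, α * y ^ q] ≠ 0),
    P = Projectivization.mk F ![x, y, α * x ^ q, α * y ^ q] h}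

def tauFun (α : F) (v : Fin 4 → F) : Fin 4 → F :=
  ![(v 2) ^ q, (v 3) ^ q, α ^ (q + 1) * (v 0) ^ q, α ^ (q + 1) * (v 1) ^ q]

/-- The collineation `τ_α : (x₁,x₂,x₃,x₄) ↦ (x₃ᑫ, x₄ᑫ, α^{q+1} x₁ᑫ, α^{q+1} x₂ᑫ)`. -/
def tau (α : F) (P : Pt F) : Pt F :=
  if h : tauFun q F α P.rep ≠ 0 then Projectivization.mk F _ h else P

/-- `s` is (the point set of) a line of `PG(3, q²)`. -/
def isLine (s : Set (Pt F)) : Prop :=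
  ∃ W : Submodule F (Fin 4 → F), Module.finrank F W = 2 ∧
    s = {P : Pt F | P.submodule ≤ W}

/-- `s` is (the point set of) a plane of `PG(3, q²)`. -/
def isPlane (s : Set (Pt F)) : Prop :=
  ∃ W : Submodule F (Fin 4 → F), Module.finrank F W = 3 ∧
    s = {P : Pt F | P.submodule ≤ W}

/-- The set of points of the line (or point) spanned by `A` and `B`. -/
def lineThrough (A B : Pt F) : Set (Pt F) :=
  {P : Pt F | P.submodule ≤ A.submodule ⊔ B.submodule}

/-- For `P = (a, b, 0, 0) ∈ t₁`, `rLine P` is the line through `(a,b,0,0)` and `(0,0,aᑫ,bᑫ)`. -/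
def rLine (P : Pt F) : Set (Pt F) := lineThrough F P (tau q F 1 P)

/-- The Desarguesian line-spread `D_α = { r_P ∩ Σ_α : P ∈ t₁ }`. -/
def Dspread (α : F) : Set (Set (Pt F)) :=
  {s | ∃ P ∈ t1 F, s = rLine q F P ∩ SigmaSet q F α}

/-- `U = { u : u^{q+1} = 1 }`. -/
def Uset : Set F := {u : F | u ^ (q + 1) = 1}

/-- The subfield `F_q` of `F_{q²}`, as a set. -/
def FqSet : Set F := {x : F | x ^ q = x}

/-- The norm image `N = { α^{q+1} : α ∈ I }`. -/
def normIm (I : Set F) : Set F := (fun α : F => α ^ (q + 1)) '' I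

/-- `I` is an index set. -/
def IsIndexSet (I : Set F) : Prop :=
  (0 : F) ∉ I ∧
  Set.InjOn (fun α : F => α ^ (q + 1)) I ∧
  (∀ a ∈ normIm q F I, a ∈ FqSet q F) ∧
  (1 : F) ∉ normIm q F I ∧
  normIm q F I ∪ Inv.inv '' normIm q F I ∪ {1} = FqSet q F \ {0} ∧
  (Even q → normIm q F I ∩ Inv.inv '' normIm q F I = ∅) ∧
  (Odd q → normIm q F I ∩ Inv.inv '' normIm q F I = {-1} ∧
    normIm q F I ∩ Neg.neg '' normIm q F I = ∅)

lemma vec4_ne_zero_fst (a b c d : F) (ha : a ≠ 0) : ![a, b, c, d] ≠ 0 := by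
  intro h
  exact ha (by simpa using congrFun h 0)

/-- The point `P_{αu} = (1, 0, αu, 0)`. -/
def Ppt (α u : F) : Pt F :=
  Projectivization.mk F ![1, 0, α * u, 0] (vec4_ne_zero_fst F 1 0 (α * u) 0 one_ne_zero)

/-- The plane `π_{αv} : X₄ = α v X₂`. -/
def planeSet (α v : F) : Set (Pt F) := {P | P.rep 3 = α * v * P.rep 1}

/-- The Baer subpencil `p(P_{αu}, π_{αv})`: the lines through `P_{αu}` contained in `π_{αv}`
meeting `Σ_α` in `q+1` points. -/
def pencil (α u v : F) : Set (Set (Pt F)) :=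
  {ℓ | isLine F ℓ ∧ Ppt F α u ∈ ℓ ∧ ℓ ⊆ planeSet F α v ∧ (ℓ ∩ SigmaSet q F α).ncard = q + 1}

/-- `m` is a line of the Baer subgeometry `Σ_η`. -/
def IsLineOfSigma (η : F) (m : Set (Pt F)) : Prop :=
  ∃ s : Set (Pt F), isLine F s ∧ m = s ∩ SigmaSet q F η ∧ m.ncard = q + 1

/-- `S` is a line-spread of `Σ_η`. -/
def IsSpreadOfSigma (η : F) (S : Set (Set (Pt F))) : Prop :=
  (∀ m ∈ S, IsLineOfSigma q F η m) ∧
  (∀ m ∈ S, ∀ m' ∈ S, m ≠ m' → m ∩ m' = ∅) ∧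
  ⋃₀ S = SigmaSet q F η

/-- `Pl` is a parallelism of `Σ_η`. -/
def IsParallelismOfSigma (η : F) (Pl : Set (Set (Set (Pt F)))) : Prop :=
  (∀ S ∈ Pl, IsSpreadOfSigma q F η S) ∧
  ∀ m : Set (Pt F), IsLineOfSigma q F η m → ∃! S, S ∈ Pl ∧ m ∈ S

/-- `R` is a regulus of `Σ_η`. -/
def IsRegulusOfSigma (η : F) (R : Set (Set (Pt F))) : Prop :=
  ∃ m1 m2 m3 : Set (Pt F),
    IsLineOfSigma q F η m1 ∧ IsLineOfSigma q F η m2 ∧ IsLineOfSigma q F η m3 ∧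
    m1 ∩ m2 = ∅ ∧ m1 ∩ m3 = ∅ ∧ m2 ∩ m3 = ∅ ∧
    R = {m | IsLineOfSigma q F η m ∧
      (m ∩ m1).Nonempty ∧ (m ∩ m2).Nonempty ∧ (m ∩ m3).Nonempty}

/-- `S_ℓ = { ⟨Q, τ_η(Q)⟩ ∩ Σ_η : Q ∈ ℓ }`. -/
def Sspread (η : F) (ℓ : Set (Pt F)) : Set (Set (Pt F)) :=
  {m | ∃ Q ∈ ℓ, m = lineThrough F Q (tau q F η Q) ∩ SigmaSet q F η}

/-- `R_ℓ = D_η ∩ S_ℓ`. -/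
def Rreg (η : F) (ℓ : Set (Pt F)) : Set (Set (Pt F)) :=
  Dspread q F η ∩ Sspread q F η ℓ

/-- `R_ℓᵒ`: the set of lines of `Σ_η` meeting every line of `R_ℓ`. -/
def Ropp (η : F) (ℓ : Set (Pt F)) : Set (Set (Pt F)) :=
  {m | IsLineOfSigma q F η m ∧ ∀ m' ∈ Rreg q F η ℓ, (m ∩ m').Nonempty}

/-- `G` is a good set (relative to the index set `I`). -/
def IsGoodSet (I : Set F) (G : Finset (F × F × F)) : Prop :=
  G.card = q + 1 ∧
  (∀ t ∈ G, t.1 ∈ I ∧ t.2.1 ∈ Uset q F ∧ t.2.2 ∈ Uset q F) ∧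
  ∀ t ∈ G, ∀ t' ∈ G, t ≠ t' →
    t.2.1 * t'.2.2 - t'.2.1 * t.2.2 ≠ 0 ∧
    t.1 * t.2.1 * (t'.1 * t'.2.2) ^ q - (t.1 * t.2.2) ^ q * (t'.1 * t'.2.1) ≠ 0

/-- `L_G = ⋃_{(α,u,v) ∈ G} ( p(P_{αu}, π_{αv}) \ {r_{U₁}} )`. -/
def Lset (G : Finset (F × F × F)) : Set (Set (Pt F)) :=
  ⋃ t ∈ G, (pencil q F t.1 t.2.1 t.2.2 \ {rU1 F})

/-- The putative parallelism `Π_G` associated with `G`. -/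
def ParP (η : F) (G : Finset (F × F × F)) : Set (Set (Set (Pt F))) :=
  {S | ∃ ℓ ∈ Lset q F G, S = (Sspread q F η ℓ \ Rreg q F η ℓ) ∪ Ropp q F η ℓ}
    ∪ {Dspread q F η}

def gFun (b : F) (v : Fin 4 → F) : Fin 4 → F :=
  ![v 0 + b * v 1, v 1, v 2 + b ^ q * v 3, v 3]

/-- The projectivity `g_b : (x₁,x₂,x₃,x₄) ↦ (x₁ + b x₂, x₂, x₃ + bᑫ x₄, x₄)`. -/
def gmap (b : F) (P : Pt F) : Pt F :=
  if h : gFun q F b P.rep ≠ 0 then Projectivization.mk F _ h else P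

end

/-- Hilbert 90 for the quadratic extension of finite fields. -/
lemma exists_pow_mul_eq_of_pow_succ_eq (q : ℕ) (hq : 1 < q) (F : Type) [Field F] [Fintype F]
    (hF : Fintype.card F = q ^ 2) {β γ : F} (hβ : β ≠ 0) (hγ : γ ≠ 0)
    (h : β ^ (q + 1) = γ ^ (q + 1)) : ∃ c : F, c ≠ 0 ∧ γ * c ^ q = c * β := by
  obtain ⟨g, hg⟩ := IsCyclic.exists_zpow_surjective (G := Fˣ)
  obtain ⟨k, hk⟩ := hg (Units.mk0 β hβ / Units.mk0 γ hγ)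
  have hpow : (Units.mk0 β hβ / Units.mk0 γ hγ) ^ (q + 1) = 1 := by
    ext
    simp [div_pow, h, hγ]
  have hord : orderOf g = (q - 1) * (q + 1) := by
    rw [orderOf_eq_card_of_zpowers_eq_top ((Subgroup.eq_top_iff' _).2 hg),
      Nat.card_eq_fintype_card, Fintype.card_units, hF]
    rw [mul_comm, ← Nat.sq_sub_sq, one_pow]
  have hdvd : ((q - 1 : ℕ) : ℤ) ∣ k := by
    rw [← hk] at hpow
    simp only [← zpow_natCast, ← zpow_mul] at hpow
    rw [← orderOf_dvd_iff_zpow_eq_one, hord, Nat.cast_mul] at hpow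
    exact Int.dvd_of_mul_dvd_mul_right (by positivity) hpow
  obtain ⟨m, rfl⟩ := hdvd
  refine ⟨((g ^ m : Fˣ) : F), Units.ne_zero _, ?_⟩
  have hroot : (g ^ m) ^ (q - 1) = Units.mk0 β hβ / Units.mk0 γ hγ := by
    rw [← hk]
    simp only [← zpow_natCast, ← zpow_mul, mul_comm m]
  have hroot' := congrArg Units.val hroot
  simp only [Units.val_pow_eq_pow_val, Units.val_div_eq_div_val, Units.val_mk0] at hroot'
  rw [eq_div_iff hγ] at hroot'
  rw [← hroot']
  nth_rewrite 1 [show q = q - 1 + 1 by lia]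
  ring

/-- `Σ_β` only depends on the norm of `β`. -/
lemma sigmaSet_subset_of_pow_succ_eq (q : ℕ) (hq : 1 < q) (F : Type) [Field F] [Fintype F]
    (hF : Fintype.card F = q ^ 2) {β γ : F} (hβ : β ≠ 0) (hγ : γ ≠ 0)
    (h : β ^ (q + 1) = γ ^ (q + 1)) : SigmaSet q F β ⊆ SigmaSet q F γ := by
  obtain ⟨c, hc, hcq⟩ := exists_pow_mul_eq_of_pow_succ_eq q hq F hF hβ hγ h
  rintro P ⟨x, y, hv, rfl⟩
  have hvec : ![c * x, c * y, γ * (c * x) ^ q, γ * (c * y) ^ q]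
      = c • ![x, y, β * x ^ q, β * y ^ q] := by
    ext i
    fin_cases i
    · simp
    · simp
    · simp [mul_pow, ← mul_assoc, hcq]
    · simp [mul_pow, ← mul_assoc, hcq]
  refine ⟨c * x, c * y, hvec ▸ smul_ne_zero hc hv, ?_⟩
  rw [Projectivization.mk_eq_mk_iff']
  exact ⟨c⁻¹, by rw [hvec, inv_smul_smul₀ hc]⟩

lemma tauFun_smul (q : ℕ) (F : Type) [Field F] (η c : F) (v : Fin 4 → F) :
    tauFun q F η (c • v) = c ^ q • tauFun q F η v := by
  ext i
  fin_cases i <;> simp [tauFun, mul_pow, mul_left_comm]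

lemma tauFun_ne_zero (q : ℕ) (F : Type) [Field F] {η : F} (hη : η ≠ 0) {v : Fin 4 → F}
    (hv : v ≠ 0) : tauFun q F η v ≠ 0 := by
  contrapose! hv
  have h0 := congrFun hv 0
  have h1 := congrFun hv 1
  have h2 := congrFun hv 2
  have h3 := congrFun hv 3
  simp only [tauFun, Matrix.cons_val, Pi.zero_apply, mul_eq_zero, pow_eq_zero_iff', hη,
    ne_eq, false_and, false_or] at h0 h1 h2 h3
  ext i
  fin_cases i
  exacts [h2.1, h3.1, h0.1, h1.1]

lemma tau_mk (q : ℕ) (F : Type) [Field F] {η : F} (hη : η ≠ 0) {v : Fin 4 → F} (hv : v ≠ 0) :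
    tau q F η (Projectivization.mk F v hv)
      = Projectivization.mk F (tauFun q F η v) (tauFun_ne_zero q F hη hv) := by
  rw [tau, dif_pos (tauFun_ne_zero q F hη (Projectivization.rep_nonzero _)),
    Projectivization.mk_eq_mk_iff']
  obtain ⟨c, hc⟩ := Projectivization.exists_smul_eq_mk_rep F v hv
  exact ⟨(c : F) ^ q, by rw [← hc, Units.smul_def, tauFun_smul]⟩

lemma tau_image_sigmaSet (q : ℕ) (F : Type) [Field F] [Fintype F]
    (hF : Fintype.card F = q ^ 2) {α η : F} (hα : α ≠ 0) (hη : η ≠ 0)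
    (hηU : η ^ (q + 1) = 1) :
    tau q F η '' SigmaSet q F α = SigmaSet q F α⁻¹ := by
  have hfrob (x : F) : (x ^ q) ^ q = x := by
    rw [← pow_mul, ← sq, ← hF, FiniteField.pow_card]
  have hvec (x y : F) : tauFun q F η ![x, y, α * x ^ q, α * y ^ q]
      = ![α ^ q * x, α ^ q * y, α⁻¹ * (α ^ q * x) ^ q, α⁻¹ * (α ^ q * y) ^ q] := by
    ext i
    fin_cases i <;> simp [tauFun, mul_pow, hfrob, hηU, hα]
  have hαq : α ^ q ≠ 0 := pow_ne_zero q hα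
  ext P
  constructor
  · rintro ⟨_, ⟨x, y, hv, rfl⟩, rfl⟩
    refine ⟨α ^ q * x, α ^ q * y, hvec x y ▸ tauFun_ne_zero q F hη hv, ?_⟩
    rw [tau_mk q F hη hv]
    simp only [hvec]
  · rintro ⟨x, y, hv, rfl⟩
    have hpre : tauFun q F η ![(α ^ q)⁻¹ * x, (α ^ q)⁻¹ * y, α * ((α ^ q)⁻¹ * x) ^ q,
        α * ((α ^ q)⁻¹ * y) ^ q] = ![x, y, α⁻¹ * x ^ q, α⁻¹ * y ^ q] := by
      simp only [hvec, mul_inv_cancel_left₀ hαq]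
    have hw : ![(α ^ q)⁻¹ * x, (α ^ q)⁻¹ * y, α * ((α ^ q)⁻¹ * x) ^ q,
        α * ((α ^ q)⁻¹ * y) ^ q] ≠ 0 := by
      intro h0
      have h1 := congrFun h0 0
      have h2 := congrFun h0 1
      have hq : q ≠ 0 := by
        rintro rfl
        simp at hF
      simp [hα] at h1 h2
      simp [h1, h2, hq] at hv
    refine ⟨_, ⟨_, _, hw, rfl⟩, ?_⟩
    rw [tau_mk q F hη hw]
    simp only [hpre]

/-- `τ_η` maps `Σ_α` onto `Σ_β` whenever `β^{q+1} = (α^{q+1})⁻¹`; in particular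
`τ_η(Σ_α) = Σ_{α^{-q}}`. -/
theorem statement1 (q : ℕ) (hq : IsPrimePow q) (F : Type) [Field F] [Fintype F]
    (hF : Fintype.card F = q ^ 2) (α η : F) (hα : α ≠ 0) (hη : η ≠ 0)
    (hηU : η ^ (q + 1) = 1) :
    (∀ β : F, β ≠ 0 → β ^ (q + 1) = (α ^ (q + 1))⁻¹ →
      tau q F η '' SigmaSet q F α = SigmaSet q F β) ∧
    tau q F η '' SigmaSet q F α = SigmaSet q F (α⁻¹ ^ q) := by
  have hmain (β : F) (hβ : β ≠ 0) (h : β ^ (q + 1) = (α ^ (q + 1))⁻¹) :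
      tau q F η '' SigmaSet q F α = SigmaSet q F β := by
    rw [← inv_pow] at h
    rw [tau_image_sigmaSet q F hF hα hη hηU]
    exact (sigmaSet_subset_of_pow_succ_eq q hq.one_lt F hF (inv_ne_zero hα) hβ h.symm).antisymm
      (sigmaSet_subset_of_pow_succ_eq q hq.one_lt F hF hβ (inv_ne_zero hα) h)
  refine ⟨hmain, hmain _ (pow_ne_zero q (inv_ne_zero hα)) ?_⟩
  have hfrob : (α⁻¹ ^ q) ^ q = α⁻¹ := by
    rw [← pow_mul, ← sq, ← hF, FiniteField.pow_card]
  rw [pow_succ, hfrob, ← inv_pow, pow_succ, mul_comm]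
end

section
/- Let q be a prime power and α, β ∈ F_{q^2} \ {0} with α^{q+1} ≠ β^{q+1}. If π is a plane of PG(3,q^2) such that π ∩ Σ_α has exactly q^2+q+1 points (a Baer subplane), then there exists a point P of t_1 such that the line r_P is contained in π and π ∩ Σ_β = r_P ∩ Σ_β; in particular π ∩ Σ_β is a member of the Desarguesian line-spread D_β and has exactly q+1 points. -/
open Projectivization Classical

lemma exists_ringHom_pow {q : ℕ} (hq : IsPrimePow q) {F : Type} [Field F] [Fintype F]
    (hF : Fintype.card F = q ^ 2) : ∃ φ : F →+* F, ∀ x, φ x = x ^ q := by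
  obtain ⟨p, k, hp, hk, rfl⟩ := hq
  obtain ⟨r, _, n, hr, hn⟩ := FiniteField.card' F
  have hpr : r = p := by
    have h : p ∣ r ^ (n : ℕ) := by
      rw [← hn, hF, ← pow_mul]
      exact dvd_pow_self p (by positivity)
    exact ((Nat.prime_dvd_prime_iff_eq hp.nat_prime hr).1 (hp.nat_prime.dvd_of_dvd_pow h)).symm
  subst hpr
  have := Fact.mk hr
  exact ⟨iterateFrobenius F r k, fun x => iterateFrobenius_def r k x⟩

lemma card_pow_eq_self_ne_zero {q : ℕ} (hq : 2 ≤ q) {F : Type} [Field F] [Fintype F]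
    (hF : Fintype.card F = q ^ 2) :
    (Finset.univ.filter fun x : F => x ≠ 0 ∧ x ^ q = x).card = q - 1 := by
  have hq1 : q - 1 + 1 = q := by omega
  have hker : Nat.card (powMonoidHom (α := Fˣ) (q - 1)).ker = q - 1 := by
    rw [IsCyclic.card_powMonoidHom_ker, Nat.card_units, Nat.card_eq_fintype_card, hF]
    refine Nat.gcd_eq_right ⟨q + 1, ?_⟩
    zify [Nat.one_le_pow 2 q (by omega), show 1 ≤ q by omega]
    ring
  rw [← hker, ← SetLike.coe_sort_coe, Nat.card_coe_set_eq, ← Set.ncard_image_of_injective _ Units.val_injective,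
    ← Set.ncard_coe_finset]
  congr 1
  ext x
  simp only [Finset.coe_filter, Finset.mem_univ, true_and, Set.mem_ofPred_eq, Set.mem_image,
    SetLike.mem_coe, MonoidHom.mem_ker, powMonoidHom_apply]
  constructor
  · rintro ⟨h0, hx⟩
    refine ⟨Units.mk0 x h0, Units.ext (mul_right_cancel₀ h0 ?_), rfl⟩
    rw [Units.val_pow_eq_pow_val, Units.val_mk0, ← pow_succ, hq1, hx, Units.val_one, one_mul]
  · rintro ⟨u, hu, rfl⟩
    refine ⟨u.ne_zero, ?_⟩
    rw [← hq1, pow_succ, ← Units.val_pow_eq_pow_val, hu, Units.val_one, one_mul]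

lemma span_sigma_eq_iff {q : ℕ} {F : Type} [Field F] {α : F} (hα : α ≠ 0)
    {s t : F × F} (ht : t ≠ 0) :
    Submodule.span F {![s.1, s.2, α * s.1 ^ q, α * s.2 ^ q]} =
        Submodule.span F {![t.1, t.2, α * t.1 ^ q, α * t.2 ^ q]} ↔
      ∃ l : F, (l ≠ 0 ∧ l ^ q = l) ∧ l • t = s := by
  rw [eq_comm, Submodule.span_singleton_eq_span_singleton]
  constructor
  · rintro ⟨u, hu⟩
    have h0 := congrFun hu 0
    have h1 := congrFun hu 1
    have h2 := congrFun hu 2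
    have h3 := congrFun hu 3
    simp only [Units.smul_def, Pi.smul_apply, smul_eq_mul, Matrix.cons_val] at h0 h1 h2 h3
    refine ⟨u, ⟨u.ne_zero, ?_⟩, Prod.ext h0 h1⟩
    rw [← h0, mul_pow] at h2
    rw [← h1, mul_pow] at h3
    by_cases h : t.1 = 0
    · have h' : t.2 ≠ 0 := fun h' => ht (Prod.ext h h')
      have : α * t.2 ^ q ≠ 0 := by positivity
      exact mul_right_cancel₀ this (by linear_combination -h3)
    · have : α * t.1 ^ q ≠ 0 := by positivity
      exact mul_right_cancel₀ this (by linear_combination -h2)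
  · rintro ⟨l, ⟨hl, hlq⟩, rfl⟩
    refine ⟨Units.mk0 l hl, ?_⟩
    funext i
    fin_cases i <;> simp [Units.smul_def, mul_pow, hlq] <;> ring

/-- A set of nonzero coordinate pairs closed under scaling by `F_q` parametrises a set of
points of `Σ_α`, each point being hit `q - 1` times. -/
lemma card_eq_mul_ncard_sigma {q : ℕ} (hq : 2 ≤ q) {F : Type} [Field F] [Fintype F]
    (hF : Fintype.card F = q ^ 2) {α : F} (hα : α ≠ 0) (S : Finset (F × F)) (T : Set (Pt F))
    (h0 : 0 ∉ S) (hS : ∀ l : F, l ≠ 0 → l ^ q = l → ∀ s ∈ S, l • s ∈ S)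
    (hT : ∀ V, (∃ P ∈ T, P.submodule = V) ↔
      ∃ s ∈ S, Submodule.span F {![s.1, s.2, α * s.1 ^ q, α * s.2 ^ q]} = V) :
    S.card = (q - 1) * T.ncard := by
  let g : F × F → Submodule F (Fin 4 → F) :=
    fun s => Submodule.span F {![s.1, s.2, α * s.1 ^ q, α * s.2 ^ q]}
  have hTc : T.ncard = (S.image g).card := by
    rw [← Set.ncard_image_of_injective _ Projectivization.submodule_injective,
      ← Set.ncard_coe_finset]
    congr 1
    ext V
    simpa [g] using hT V
  rw [hTc, Finset.card_eq_sum_card_image g S, mul_comm]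
  refine Finset.sum_const_nat fun V hV => ?_
  obtain ⟨t, ht, rfl⟩ := Finset.mem_image.1 hV
  have ht0 : t ≠ 0 := fun h => h0 (h ▸ ht)
  rw [← card_pow_eq_self_ne_zero hq hF,
    ← Finset.card_image_of_injective _ (smul_left_injective F ht0)]
  congr 1
  ext s
  simp only [Finset.mem_filter, Finset.mem_image, Finset.mem_univ, true_and]
  rw [← span_sigma_eq_iff hα ht0]
  refine and_iff_right_of_imp fun h => ?_
  obtain ⟨l, ⟨hl, hlq⟩, rfl⟩ := (span_sigma_eq_iff hα ht0).1 h
  exact hS l hl hlq t ht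

lemma eq_zero_of_forall_mul_pow_eq_mul {q : ℕ} (hq : 2 ≤ q) {F : Type} [Field F] [Fintype F]
    (hF : Fintype.card F = q ^ 2) {A B : F} (h : ∀ x, A * x ^ q = B * x) : A = 0 := by
  by_contra hA
  have hAB : A = B := by simpa using h 1
  have hx : ∀ x : F, x ^ q = x := fun x => mul_left_cancel₀ hA (by rw [h x, hAB])
  have hcard := card_pow_eq_self_ne_zero hq hF
  simp only [hx, and_true] at hcard
  rw [Finset.filter_ne', Finset.card_erase_of_mem (Finset.mem_univ _), Finset.card_univ, hF]
    at hcard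
  have : q < q ^ 2 := by nlinarith
  omega

/-- An additive map `F × F → F` that commutes with scaling by `F_q` and has a kernel of size
`q ^ 3` takes its values in a one-dimensional `F_q`-subspace. -/
lemma exists_pow_eq_mul_of_card_ker {q : ℕ} (hq : 2 ≤ q) {F : Type} [Field F] [Fintype F]
    (hF : Fintype.card F = q ^ 2) (f : F × F →+ F)
    (hf : ∀ l s, l ^ q = l → f (l • s) = l * f s) (hker : Nat.card f.ker = q ^ 3) :
    ∃ κ : F, κ ^ (q + 1) = 1 ∧ ∀ s, f s ^ q = κ * f s := by
  have hrange : (Finset.univ.filter fun x : F => ∃ s, f s = x).card = q := by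
    have h := f.ker.card_mul_index
    rw [AddSubgroup.index_ker, hker, Nat.card_prod, Nat.card_eq_fintype_card (α := F), hF,
      show q ^ 2 * q ^ 2 = q ^ 3 * q by ring] at h
    have h' := Nat.eq_of_mul_eq_mul_left (by positivity) h
    rw [← Set.ncard_coe_finset]
    conv_rhs => rw [← h', ← SetLike.coe_sort_coe, Nat.card_coe_set_eq]
    congr 1
    ext x
    simp
  obtain ⟨m, ⟨s₀, rfl⟩, hm⟩ : ∃ x : F, (∃ s, f s = x) ∧ x ≠ 0 := by
    by_contra! h
    have : (Finset.univ.filter fun x : F => ∃ s, f s = x) ⊆ {0} := fun x hx =>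
      Finset.mem_singleton.2 (h x (Finset.mem_filter.1 hx).2)
    have := Finset.card_le_card this
    rw [hrange, Finset.card_singleton] at this
    omega
  have himage : (Finset.univ.filter fun x : F => x ≠ 0 ∧ x ^ q = x).image (· * f s₀) =
      (Finset.univ.filter fun x : F => ∃ s, f s = x).erase 0 := by
    refine Finset.eq_of_subset_of_card_le (fun x hx => ?_) ?_
    · obtain ⟨l, hl, rfl⟩ := Finset.mem_image.1 hx
      obtain ⟨-, hl0, hlq⟩ := Finset.mem_filter.1 hl
      exact Finset.mem_erase.2 ⟨mul_ne_zero hl0 hm,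
        Finset.mem_filter.2 ⟨Finset.mem_univ _, l • s₀, hf l s₀ hlq⟩⟩
    · rw [Finset.card_image_of_injective _ (mul_left_injective₀ hm),
        card_pow_eq_self_ne_zero hq hF, Finset.card_erase_of_mem, hrange]
      exact Finset.mem_filter.2 ⟨Finset.mem_univ _, 0, map_zero f⟩
  refine ⟨f s₀ ^ q / f s₀, ?_, fun s => ?_⟩
  · have h : f s₀ ^ (q ^ 2) = f s₀ := by rw [← hF, FiniteField.pow_card]
    rw [div_pow, div_eq_one_iff_eq (pow_ne_zero _ hm), ← pow_mul,
      show q * (q + 1) = q ^ 2 + q by ring, pow_add, h, pow_succ, mul_comm]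
  · by_cases hs : f s = 0
    · simp [hs, show q ≠ 0 by omega]
    · have h : f s ∈ (Finset.univ.filter fun x : F => ∃ s, f s = x).erase 0 :=
        Finset.mem_erase.2 ⟨hs, Finset.mem_filter.2 ⟨Finset.mem_univ _, s, rfl⟩⟩
      rw [← himage] at h
      obtain ⟨l, hl, hls⟩ := Finset.mem_image.1 h
      rw [← hls, mul_pow, (Finset.mem_filter.1 hl).2.2]
      field_simp

/-- The coefficients of a plane meeting `Σ_α` in a Baer subplane. -/
lemma exists_coeff_eq_of_card_sigma {q : ℕ} (hq : IsPrimePow q) {F : Type} [Field F] [Fintype F]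
    (hF : Fintype.card F = q ^ 2) {α a b c d : F}
    (hcard : (Finset.univ.filter fun s : F × F =>
      s ≠ 0 ∧ a * s.1 + b * s.2 + c * (α * s.1 ^ q) + d * (α * s.2 ^ q) = 0).card =
        (q - 1) * (q ^ 2 + q + 1)) :
    ∃ γ : F, γ ^ (q + 1) = α ^ (q + 1) ∧ a ^ q = γ * c ∧ b ^ q = γ * d := by
  have hq2 : 2 ≤ q := hq.two_le
  obtain ⟨φ, hφ⟩ := exists_ringHom_pow hq hF
  have hφφ : ∀ x, φ (φ x) = x := fun x => by
    rw [hφ, hφ, ← pow_mul, ← sq, ← hF, FiniteField.pow_card]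
  let f : F × F →+ F := AddMonoidHom.mk'
    (fun s => a * s.1 + b * s.2 + c * (α * s.1 ^ q) + d * (α * s.2 ^ q)) fun s t => by
      simp only [← hφ, Prod.fst_add, Prod.snd_add, map_add]
      ring
  have hfs : ∀ s, f s = a * s.1 + b * s.2 + c * (α * φ s.1) + d * (α * φ s.2) := fun s => by
    simp [f, hφ]
  have hker : Nat.card f.ker = q ^ 3 := by
    have h : (f.ker : Set (F × F)) = (insert 0 (Finset.univ.filter fun s : F × F =>
      s ≠ 0 ∧ a * s.1 + b * s.2 + c * (α * s.1 ^ q) + d * (α * s.2 ^ q) = 0) : Finset _) := by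
      ext s
      by_cases hs : s = 0
      · simp [hs]
      · simp [hs, f, AddMonoidHom.mem_ker]
    rw [← SetLike.coe_sort_coe, Nat.card_coe_set_eq, h, Set.ncard_coe_finset,
      Finset.card_insert_of_notMem (by simp), hcard]
    zify [show 1 ≤ q by omega]
    ring
  obtain ⟨κ, hκ, hfκ⟩ := exists_pow_eq_mul_of_card_ker hq2 hF f (fun l s hl => by
    simp only [hfs, Prod.smul_fst, Prod.smul_snd, smul_eq_mul, map_mul, hφ l, hl]
    ring) hker
  refine ⟨κ * α, by rw [mul_pow, hκ, one_mul], ?_, ?_⟩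
  · refine sub_eq_zero.1 (eq_zero_of_forall_mul_pow_eq_mul hq2 hF
      (B := κ * a - φ c * φ α) fun x => ?_)
    have h := hfκ (x, 0)
    simp only [← hφ, hfs, map_add, map_mul, hφφ, map_zero] at h ⊢
    linear_combination h
  · refine sub_eq_zero.1 (eq_zero_of_forall_mul_pow_eq_mul hq2 hF
      (B := κ * b - φ d * φ α) fun x => ?_)
    have h := hfκ (0, x)
    simp only [← hφ, hfs, map_add, map_mul, hφφ, map_zero] at h ⊢
    linear_combination h

lemma exists_coeff_of_finrank_eq_three {F : Type} [Field F] {W : Submodule F (Fin 4 → F)}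
    (hW : Module.finrank F W = 3) :
    ∃ a b c d : F, (a ≠ 0 ∨ b ≠ 0 ∨ c ≠ 0 ∨ d ≠ 0) ∧
      ∀ v, v ∈ W ↔ a * v 0 + b * v 1 + c * v 2 + d * v 3 = 0 := by
  obtain ⟨f, hf0, hf⟩ := Submodule.exists_le_ker_of_lt_top W (lt_top_iff_ne_top.2 fun h => by
    rw [h, finrank_top, Module.finrank_fin_fun] at hW
    omega)
  obtain ⟨a, b, c, d, hval⟩ : ∃ a b c d, ∀ v, f v = a * v 0 + b * v 1 + c * v 2 + d * v 3 :=
    ⟨_, _, _, _, fun v => by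
      rw [LinearMap.pi_apply_eq_sum_univ f v]
      simp only [Fin.sum_univ_four, smul_eq_mul, mul_comm (v _)]
      rfl⟩
  have hker : W = LinearMap.ker f := by
    refine Submodule.eq_of_le_of_finrank_le hf ?_
    have hlt := Submodule.finrank_lt (s := LinearMap.ker f) fun h => hf0 (LinearMap.ker_eq_top.1 h)
    rw [Module.finrank_fin_fun] at hlt
    omega
  refine ⟨a, b, c, d, ?_, fun v => by rw [hker, LinearMap.mem_ker, hval v]⟩
  by_contra! h
  refine hf0 (LinearMap.ext fun v => ?_)
  rw [hval, h.1, h.2.1, h.2.2.1, h.2.2.2]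
  simp

lemma sigma_vec_ne_zero {q : ℕ} {F : Type} [Field F] {α : F} {s : F × F} (hs : s ≠ 0) :
    ![s.1, s.2, α * s.1 ^ q, α * s.2 ^ q] ≠ 0 := fun h =>
  hs (Prod.ext (by simpa using congrFun h 0) (by simpa using congrFun h 1))

/-- Counting the points of `Σ_α` in a subspace through their coordinate pairs. -/
lemma card_sigma_mem_submodule {q : ℕ} (hq : 2 ≤ q) {F : Type} [Field F] [Fintype F]
    (hF : Fintype.card F = q ^ 2) {α : F} (hα : α ≠ 0) (W : Submodule F (Fin 4 → F)) :
    (Finset.univ.filter fun s : F × F =>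
      s ≠ 0 ∧ ![s.1, s.2, α * s.1 ^ q, α * s.2 ^ q] ∈ W).card =
      (q - 1) * ({P : Pt F | P.submodule ≤ W} ∩ SigmaSet q F α).ncard := by
  refine card_eq_mul_ncard_sigma hq hF hα _ _ (by simp) (fun l hl hlq s hs => ?_) fun V => ?_
  · obtain ⟨-, hs0, hsW⟩ := Finset.mem_filter.1 hs
    refine Finset.mem_filter.2 ⟨Finset.mem_univ _, smul_ne_zero hl hs0, ?_⟩
    convert W.smul_mem l hsW using 1
    funext i
    fin_cases i <;> simp [mul_pow, hlq] <;> ring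
  · constructor
    · rintro ⟨_, ⟨hP, x, y, h, rfl⟩, rfl⟩
      refine ⟨(x, y), Finset.mem_filter.2 ⟨Finset.mem_univ _, fun h0 => h ?_, ?_⟩,
        (Projectivization.submodule_mk _ h).symm⟩
      · obtain ⟨rfl, rfl⟩ := Prod.ext_iff.1 h0
        funext i
        fin_cases i <;> simp [show q ≠ 0 by omega]
      · simpa using hP
    · rintro ⟨s, hs, rfl⟩
      obtain ⟨-, hs0, hsW⟩ := Finset.mem_filter.1 hs
      exact ⟨Projectivization.mk F _ (sigma_vec_ne_zero hs0),
        ⟨by simpa using hsW, s.1, s.2, sigma_vec_ne_zero hs0, rfl⟩,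
        Projectivization.submodule_mk _ _⟩

lemma mk_mem_t1 {F : Type} [Field F] {x y : F} (h : ![x, y, 0, 0] ≠ 0) :
    Projectivization.mk F ![x, y, 0, 0] h ∈ t1 F := by
  obtain ⟨u, hu⟩ := Projectivization.exists_smul_eq_mk_rep F _ h
  rw [t1, Set.mem_ofPred_eq, ← hu]
  simp

lemma rLine_mk {q : ℕ} (hq : q ≠ 0) {F : Type} [Field F] {x y : F} (h : ![x, y, 0, 0] ≠ 0) :
    rLine q F (Projectivization.mk F ![x, y, 0, 0] h) =
      {Q : Pt F | Q.submodule ≤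
        Submodule.span F {![x, y, 0, 0]} ⊔ Submodule.span F {![0, 0, x ^ q, y ^ q]}} := by
  obtain ⟨u, hu⟩ := Projectivization.exists_smul_eq_mk_rep F _ h
  have htau : tauFun q F 1 (Projectivization.mk F ![x, y, 0, 0] h).rep =
      u ^ q • ![0, 0, x ^ q, y ^ q] := by
    rw [← hu]
    funext i
    fin_cases i <;> simp [tauFun, Units.smul_def, mul_pow, hq]
  have hne : tauFun q F 1 (Projectivization.mk F ![x, y, 0, 0] h).rep ≠ 0 := by
    rw [htau, Ne, smul_eq_zero_iff_eq]
    intro h0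
    have hx : x ^ q = 0 := by simpa using congrFun h0 2
    have hy : y ^ q = 0 := by simpa using congrFun h0 3
    rw [pow_eq_zero_iff hq] at hx hy
    subst hx hy
    exact h (by funext i; fin_cases i <;> rfl)
  have hsub : (tau q F 1 (Projectivization.mk F ![x, y, 0, 0] h)).submodule =
      Submodule.span F {![0, 0, x ^ q, y ^ q]} := by
    rw [tau, dif_pos hne, Projectivization.submodule_mk, htau,
      Submodule.span_singleton_group_smul_eq]
  rw [rLine, lineThrough, hsub, Projectivization.submodule_mk]

/-- If `γ` and `β` have different norms, `γ z + β z ^ q` vanishes only at `z = 0`. -/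
lemma eq_zero_of_mul_add_mul_pow_eq_zero {q : ℕ} {F : Type} [Field F] [Fintype F]
    (hF : Fintype.card F = q ^ 2) {φ : F →+* F} (hφ : ∀ x, φ x = x ^ q) {γ β z : F}
    (hne : γ ^ (q + 1) ≠ β ^ (q + 1)) (hz : γ * z + β * z ^ q = 0) : z = 0 := by
  have hφφ : φ (φ z) = z := by
    rw [hφ, hφ, ← pow_mul, ← sq, ← hF, FiniteField.pow_card]
  rw [pow_succ, pow_succ, ← hφ, ← hφ, ← sub_ne_zero] at hne
  rw [← hφ] at hz
  have hz' := congrArg φ hz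
  simp only [map_add, map_mul, map_zero, hφφ] at hz'
  by_contra h
  have h' : φ z ≠ 0 := (map_ne_zero φ).2 h
  refine mul_ne_zero (mul_ne_zero hne h) h' ?_
  linear_combination (φ γ * φ z) * hz - (β * φ z) * hz'

/-- A plane meeting `Σ_α` in a Baer subplane meets `Σ_β` in a line of the
Desarguesian spread `D_β`. -/
theorem statement2 (q : ℕ) (hq : IsPrimePow q) (F : Type) [Field F] [Fintype F]
    (hF : Fintype.card F = q ^ 2) (α β : F) (hα : α ≠ 0) (hβ : β ≠ 0)
    (hnorm : α ^ (q + 1) ≠ β ^ (q + 1))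
    (π : Set (Pt F)) (hπ : isPlane F π)
    (hbaer : (π ∩ SigmaSet q F α).ncard = q ^ 2 + q + 1) :
    ∃ P ∈ t1 F, rLine q F P ⊆ π ∧
      π ∩ SigmaSet q F β = rLine q F P ∩ SigmaSet q F β ∧
      (π ∩ SigmaSet q F β) ∈ Dspread q F β ∧
      (π ∩ SigmaSet q F β).ncard = q + 1 := by
  have hq2 : 2 ≤ q := hq.two_le
  have hq0 : q ≠ 0 := by omega
  obtain ⟨φ, hφ⟩ := exists_ringHom_pow hq hF
  obtain ⟨W, hW, rfl⟩ := hπ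
  obtain ⟨a, b, c, d, hne, hmem⟩ := exists_coeff_of_finrank_eq_three hW
  have hcount := card_sigma_mem_submodule hq2 hF hα W
  simp only [hmem, hbaer, Matrix.cons_val] at hcount
  obtain ⟨γ, hγ, hac, hbd⟩ := exists_coeff_eq_of_card_sigma hq hF hcount
  have hγ0 : γ ≠ 0 := by
    rintro rfl
    exact pow_ne_zero (q + 1) hα (by rw [← hγ, zero_pow (by omega)])
  have hab : a ≠ 0 ∨ b ≠ 0 := by
    by_contra! h
    obtain ⟨rfl, rfl⟩ := h
    simp only [zero_pow hq0, zero_eq_mul, hγ0, false_or] at hac hbd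
    simp [hac, hbd] at hne
  have hv : ![-b, a, 0, 0] ≠ 0 := fun h => by
    rcases hab with h' | h'
    · exact h' (by simpa using congrFun h 1)
    · exact h' (by simpa using congrFun h 0)
  have hvec : ((-b, a) : F × F) ≠ 0 := fun h => by
    rcases hab with h' | h'
    · exact h' (Prod.ext_iff.1 h).2
    · exact h' (neg_eq_zero.1 (Prod.ext_iff.1 h).1)
  have hsigma : ∀ s : F × F,
      ![s.1, s.2, β * s.1 ^ q, β * s.2 ^ q] ∈ W ↔ ∃ t : F, t • ((-b, a) : F × F) = s := by
    rintro ⟨x, y⟩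
    have key : a * x + b * y = 0 ↔ ∃ t : F, t • ((-b, a) : F × F) = (x, y) := by
      constructor
      · intro h
        rcases hab with h' | h'
        · refine ⟨y / a, Prod.ext ?_ ?_⟩ <;> simp <;> field_simp
          linear_combination -h
        · refine ⟨-x / b, Prod.ext ?_ ?_⟩ <;> simp <;> field_simp
          linear_combination -h
      · rintro ⟨t, ht⟩
        obtain ⟨rfl, rfl⟩ := Prod.ext_iff.1 ht
        simp only [smul_eq_mul, Prod.smul_fst, Prod.smul_snd]
        ring
    rw [← key, hmem]
    simp only [Matrix.cons_val]
    simp only [← hφ] at hac hbd ⊢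
    constructor
    · intro h
      refine eq_zero_of_mul_add_mul_pow_eq_zero hF hφ (hγ ▸ hnorm) ?_
      rw [← hφ, map_add, map_mul, map_mul]
      linear_combination γ * h + β * φ x * hac + β * φ y * hbd
    · intro h
      have h' := congrArg φ h
      simp only [map_add, map_mul, map_zero] at h'
      refine mul_left_cancel₀ hγ0 ?_
      linear_combination γ * h + β * h' - β * φ x * hac - β * φ y * hbd
  have hrsub : rLine q F (Projectivization.mk F ![-b, a, 0, 0] hv) ⊆
      {P : Pt F | P.submodule ≤ W} := by
    rw [rLine_mk hq0]
    intro Q hQ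
    rw [Set.mem_ofPred_eq] at hQ ⊢
    refine hQ.trans (sup_le ?_ ?_)
    · rw [Submodule.span_singleton_le_iff_mem, hmem]
      simp only [Matrix.cons_val]
      ring
    · rw [Submodule.span_singleton_le_iff_mem, hmem]
      simp only [Matrix.cons_val]
      refine mul_left_cancel₀ hγ0 ?_
      rw [← hφ, ← hφ, map_neg]
      rw [← hφ] at hac hbd
      linear_combination φ b * hac - φ a * hbd
  have hinter : {P : Pt F | P.submodule ≤ W} ∩ SigmaSet q F β =
      rLine q F (Projectivization.mk F ![-b, a, 0, 0] hv) ∩ SigmaSet q F β := by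
    refine Set.Subset.antisymm ?_ (Set.inter_subset_inter_left _ hrsub)
    rintro _ ⟨hP, x, y, h, rfl⟩
    refine ⟨?_, x, y, h, rfl⟩
    rw [Set.mem_ofPred_eq, Projectivization.submodule_mk,
      Submodule.span_singleton_le_iff_mem] at hP
    obtain ⟨t, ht⟩ := (hsigma (x, y)).1 hP
    obtain ⟨rfl, rfl⟩ := Prod.ext_iff.1 ht
    rw [rLine_mk hq0, Set.mem_ofPred_eq, Projectivization.submodule_mk,
      Submodule.span_singleton_le_iff_mem]
    refine Submodule.mem_sup.2 ⟨t • ![-b, a, 0, 0],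
      Submodule.smul_mem _ _ (Submodule.mem_span_singleton_self _),
      (β * t ^ q) • ![0, 0, (-b) ^ q, a ^ q],
      Submodule.smul_mem _ _ (Submodule.mem_span_singleton_self _), ?_⟩
    funext i
    fin_cases i <;> simp [← hφ, mul_assoc]
  refine ⟨_, mk_mem_t1 hv, hrsub, hinter, ⟨_, mk_mem_t1 hv, hinter⟩, ?_⟩
  have hcountβ := card_sigma_mem_submodule hq2 hF hβ W
  have himage : (Finset.univ.filter fun s : F × F =>
      s ≠ 0 ∧ ![s.1, s.2, β * s.1 ^ q, β * s.2 ^ q] ∈ W) =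
      (Finset.univ.erase (0 : F)).image (· • ((-b, a) : F × F)) := by
    ext s
    simp only [hsigma, Finset.mem_filter, Finset.mem_univ, true_and, Finset.mem_image,
      Finset.mem_erase, and_true]
    constructor
    · rintro ⟨hs, t, rfl⟩
      exact ⟨t, (smul_ne_zero_iff.1 hs).1, rfl⟩
    · rintro ⟨t, ht, rfl⟩
      exact ⟨smul_ne_zero ht hvec, t, rfl⟩
  rw [himage, Finset.card_image_of_injective _ (smul_left_injective F hvec),
    Finset.card_erase_of_mem (Finset.mem_univ _), Finset.card_univ, hF] at hcountβ
  refine Nat.eq_of_mul_eq_mul_left (show 0 < q - 1 by omega) (hcountβ.symm.trans ?_)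
  zify [Nat.one_le_pow 2 q (by omega), show 1 ≤ q by omega]
  ring
end

section
/- Let q be a prime power and α, β ∈ F_{q^2} \ {0} with α^{q+1} ≠ β^{q+1}. If ℓ is a line of PG(3,q^2) such that ℓ ∩ Σ_α has exactly q+1 points (a Baer subline) and ℓ ≠ r_P for every point P of t_1, then ℓ ∩ Σ_β = ∅. -/
open Projectivization Classical

/-- The homogeneous coordinates of the point of `Σ_α` with parameters `x`, `y`. -/
def sigmaVec {F : Type} [Field F] (q : ℕ) (α x y : F) : Fin 4 → F :=
  ![x, y, α * x ^ q, α * y ^ q]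

lemma add_pow_of_card_eq_sq {F : Type} [Field F] [Fintype F] {q : ℕ} (hq : IsPrimePow q)
    (hF : Fintype.card F = q ^ 2) (x y : F) : (x + y) ^ q = x ^ q + y ^ q := by
  obtain ⟨p, k, hp, -, rfl⟩ := hq
  have : Fact p.Prime := ⟨hp.nat_prime⟩
  have : CharP F p := charP_of_card_eq_prime_pow (f := k * 2) (by
    rw [hF, pow_mul])
  exact add_pow_char_pow x y p k

/-- If `α z = β z^q` for some nonzero `z`, then `α` and `β` have the same norm. -/
lemma pow_succ_eq_of_mul_eq_mul_pow {F : Type} [Field F] [Fintype F] {q : ℕ}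
    (hF : Fintype.card F = q ^ 2) {α β z : F} (hz : z ≠ 0) (h : α * z = β * z ^ q) :
    α ^ (q + 1) = β ^ (q + 1) := by
  have hzq : z ^ (q ^ 2) = z := by rw [← hF]; exact FiniteField.pow_card z
  have h2 : (α * z) ^ (q + 1) = (β * z ^ q) ^ (q + 1) := by rw [h]
  have h3 : (z ^ q) ^ (q + 1) = z ^ (q + 1) := by
    rw [← pow_mul, mul_add, mul_one, pow_add, ← sq, hzq, pow_succ, mul_comm]
  rw [mul_pow, mul_pow, h3] at h2
  exact mul_right_cancel₀ (pow_ne_zero _ hz) h2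

/-- A nonzero vector of `Σ_β` on the span of two vectors of `Σ_α` with independent parameters
forces `α` and `β` to have the same norm. -/
lemma pow_succ_eq_of_sigmaVec_mem_span {F : Type} [Field F] [Fintype F] {q : ℕ}
    (hq : IsPrimePow q) (hF : Fintype.card F = q ^ 2) {α β x y x' y' s t : F}
    (hD : x * y' - x' * y ≠ 0) (hst : sigmaVec q β s t ≠ 0)
    (hmem : sigmaVec q β s t ∈ Submodule.span F {sigmaVec q α x y, sigmaVec q α x' y'}) :
    α ^ (q + 1) = β ^ (q + 1) := by
  have hadd := add_pow_of_card_eq_sq hq hF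
  have hDq : x ^ q * y' ^ q - x' ^ q * y ^ q ≠ 0 := by
    intro h0
    apply pow_ne_zero q hD
    have h1 := hadd (x * y' - x' * y) (x' * y)
    rw [sub_add_cancel, mul_pow, mul_pow] at h1
    linear_combination h0 - h1
  obtain ⟨a, b, hab⟩ := Submodule.mem_span_pair.1 hmem
  have h0 := congrFun hab 0
  have h1 := congrFun hab 1
  have h2 := congrFun hab 2
  have h3 := congrFun hab 3
  simp [sigmaVec] at h0 h1 h2 h3
  rw [← h0, hadd, mul_pow, mul_pow] at h2
  rw [← h1, hadd, mul_pow, mul_pow] at h3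
  have ha : α * a = β * a ^ q :=
    mul_right_cancel₀ hDq (by linear_combination y' ^ q * h2 - x' ^ q * h3)
  have hb : α * b = β * b ^ q :=
    mul_right_cancel₀ hDq (by linear_combination x ^ q * h3 - y ^ q * h2)
  by_cases ha0 : a = 0
  · by_cases hb0 : b = 0
    · exact absurd (by rw [← hab, ha0, hb0]; simp) hst
    · exact pow_succ_eq_of_mul_eq_mul_pow hF hb0 hb
  · exact pow_succ_eq_of_mul_eq_mul_pow hF ha0 ha

/-- The vectors of `Σ_α` with parameters proportional to `(a, b)` lie on `r_P`,
`P = (a, b, 0, 0)`, which is a line (or a point). -/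
lemma exists_mem_t1_rLine {F : Type} [Field F] {q : ℕ} (hq0 : q ≠ 0) (α a b : F)
    (hab : ![a, b, 0, 0] ≠ 0) :
    ∃ P ∈ t1 F, ∃ R : Submodule F (Fin 4 → F), Module.finrank F R ≤ 2 ∧
      rLine q F P = {Q : Pt F | Q.submodule ≤ R} ∧
      ∀ c : F, sigmaVec q α (c * a) (c * b) ∈ R := by
  obtain ⟨k, hk⟩ := Projectivization.exists_smul_eq_mk_rep F _ hab
  set P : Pt F := Projectivization.mk F ![a, b, 0, 0] hab with hP
  have r0 : P.rep 0 = k * a := by rw [← hk]; simp [Units.smul_def]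
  have r1 : P.rep 1 = k * b := by rw [← hk]; simp [Units.smul_def]
  have r2 : P.rep 2 = 0 := by rw [← hk]; simp
  have r3 : P.rep 3 = 0 := by rw [← hk]; simp
  have hk0 : (k : F) ≠ 0 := k.ne_zero
  have htau : tauFun q F 1 P.rep = ![0, 0, (k * a) ^ q, (k * b) ^ q] := by
    simp [tauFun, r0, r1, r2, r3, hq0]
  have hne : tauFun q F 1 P.rep ≠ 0 := by
    rw [htau]
    intro h
    apply hab
    have h2 := congrFun h 2
    have h3 := congrFun h 3
    simp [hq0] at h2 h3
    simp [h2, h3]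
  refine ⟨P, ⟨r2, r3⟩, P.submodule ⊔ (tau q F 1 P).submodule, ?_, rfl, fun c => ?_⟩
  · refine (Submodule.finrank_add_le_finrank_add_finrank _ _).trans ?_
    rw [Projectivization.finrank_submodule, Projectivization.finrank_submodule]
  · have htP : (tau q F 1 P).submodule = Submodule.span F {tauFun q F 1 P.rep} := by
      rw [tau, dif_pos hne, Projectivization.submodule_mk]
    rw [htP, hP, Projectivization.submodule_mk, ← hP, ← Submodule.span_union,
      Set.singleton_union, Submodule.mem_span_pair]
    refine ⟨c, α * c ^ q * ((k : F) ^ q)⁻¹, ?_⟩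
    have hkq : (k : F) ^ q ≠ 0 := pow_ne_zero _ hk0
    rw [htau]
    ext i
    fin_cases i <;> simp [sigmaVec, mul_pow] <;> field_simp

/-- A line meeting `Σ_α` in a Baer subline which is not one of the lines `r_P` is
disjoint from `Σ_β`. -/
theorem statement3 (q : ℕ) (hq : IsPrimePow q) (F : Type) [Field F] [Fintype F]
    (hF : Fintype.card F = q ^ 2) (α β : F) (hα : α ≠ 0) (hβ : β ≠ 0)
    (hnorm : α ^ (q + 1) ≠ β ^ (q + 1))
    (ℓ : Set (Pt F)) (hℓ : isLine F ℓ)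
    (hbaer : (ℓ ∩ SigmaSet q F α).ncard = q + 1)
    (hnr : ∀ P ∈ t1 F, ℓ ≠ rLine q F P) :
    ℓ ∩ SigmaSet q F β = ∅ := by
  have hq0 : q ≠ 0 := hq.pos.ne'
  obtain ⟨W, hW, rfl⟩ := hℓ
  have hfin := Set.finite_of_ncard_ne_zero (by rw [hbaer]; exact Nat.succ_ne_zero q)
  obtain ⟨A, B, ⟨hAW, x, y, hv, rfl⟩, ⟨hBW, x', y', hw, rfl⟩, hne⟩ :=
    (Set.one_lt_ncard_iff hfin).1 (by rw [hbaer]; have := hq.pos; omega)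
  change sigmaVec q α x y ≠ 0 at hv
  change sigmaVec q α x' y' ≠ 0 at hw
  change (Projectivization.mk F (sigmaVec q α x y) hv).submodule ≤ W at hAW
  change (Projectivization.mk F (sigmaVec q α x' y') hw).submodule ≤ W at hBW
  rw [Projectivization.submodule_mk, Submodule.span_singleton_le_iff_mem] at hAW hBW
  have hli : LinearIndependent F ![sigmaVec q α x y, sigmaVec q α x' y'] := by
    rw [LinearIndependent.pair_iff' hv]
    intro c hc
    exact hne ((Projectivization.mk_eq_mk_iff' F _ _ hv hw).2
      ⟨c⁻¹, by
        have hc0 : c ≠ 0 := by rintro rfl; exact hw (by rw [← hc, zero_smul])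
        change c⁻¹ • sigmaVec q α x' y' = sigmaVec q α x y
        rw [← hc, inv_smul_smul₀ hc0]⟩)
  have hspan : Submodule.span F {sigmaVec q α x y, sigmaVec q α x' y'} = W := by
    apply Submodule.eq_of_le_of_finrank_le
    · rw [Submodule.span_le]
      rintro _ (rfl | rfl)
      exacts [hAW, hBW]
    · have := finrank_span_eq_card hli
      rw [Matrix.range_cons_cons_empty] at this
      rw [this, hW, Fintype.card_fin]
  have hD : x * y' - x' * y ≠ 0 := by
    intro hD
    have hxy : ![x, y, 0, 0] ≠ 0 := by
      intro h
      have h0 := congrFun h 0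
      have h1 := congrFun h 1
      simp at h0 h1
      exact hv (by ext i; fin_cases i <;> simp [sigmaVec, h0, h1, hq0])
    obtain ⟨P, hP, R, hR, hPR, hmem⟩ := exists_mem_t1_rLine hq0 α x y hxy
    refine hnr P hP ?_
    obtain ⟨c, hx, hy⟩ : ∃ c : F, x' = c * x ∧ y' = c * y := by
      by_cases hx : x = 0
      · have hy : y ≠ 0 := by rintro rfl; exact hxy (by simp [hx])
        have hx' : x' = 0 := by simpa [hx, hy] using hD
        exact ⟨y' / y, by simp [hx, hx'], by field_simp⟩
      · refine ⟨x' / x, by field_simp, ?_⟩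
        field_simp
        linear_combination hD
    have hWR : W = R := by
      apply Submodule.eq_of_le_of_finrank_le
      · rw [← hspan, Submodule.span_le]
        rintro _ (rfl | rfl)
        · simpa using hmem 1
        · rw [hx, hy]; exact hmem c
      · rwa [hW]
    rw [hPR, hWR]
  refine Set.eq_empty_of_forall_notMem ?_
  rintro _ ⟨hQ, s, t, hst, rfl⟩
  rw [Set.mem_ofPred_eq, Projectivization.submodule_mk, Submodule.span_singleton_le_iff_mem,
    ← hspan] at hQ
  exact hnorm (pow_succ_eq_of_sigmaVec_mem_span hq hF hD hst hQ)
end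

section
/- Let q be a prime power. The set of points D̄ := ⋃_{P ∈ t_1} r_P (the union of the point sets of the lines r_P, P ranging over the points of t_1) has exactly (q^2+1)^2 points. -/
open Projectivization Classical

/-- The vector `(c₀ v₀, c₀ v₁, c₁ v₀ᑫ, c₁ v₁ᑫ)`, on the line spanned by `(v₀, v₁, 0, 0)` and
`(0, 0, v₀ᑫ, v₁ᑫ)`. -/
def spreadVec {F : Type} [Field F] (q : ℕ) (v c : Fin 2 → F) : Fin 4 → F :=
  ![c 0 * v 0, c 0 * v 1, c 1 * v 0 ^ q, c 1 * v 1 ^ q]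

section SpreadVec

variable {F : Type} [Field F] {q : ℕ}

lemma ne_zero_fin_two_iff {v : Fin 2 → F} : v ≠ 0 ↔ v 0 ≠ 0 ∨ v 1 ≠ 0 := by
  simp only [ne_eq, funext_iff, Fin.forall_fin_two, Pi.zero_apply]
  tauto

lemma spreadVec_ne_zero_iff (hq : q ≠ 0) {v c : Fin 2 → F} :
    spreadVec q v c ≠ 0 ↔ v ≠ 0 ∧ c ≠ 0 := by
  rw [ne_zero_fin_two_iff, ne_zero_fin_two_iff]
  simp only [spreadVec, ne_eq, funext_iff, Fin.forall_fin_succ]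
  simp [hq]
  tauto

lemma spreadVec_smul_right (s : F) (v c : Fin 2 → F) :
    spreadVec q v (s • c) = s • spreadVec q v c := by
  ext i
  fin_cases i <;> simp [spreadVec, mul_assoc]

lemma spreadVec_smul_left (t : F) (v c : Fin 2 → F) :
    spreadVec q (t • v) c = spreadVec q v ![c 0 * t, c 1 * t ^ q] := by
  ext i
  fin_cases i <;> simp [spreadVec, mul_assoc, mul_pow]

lemma spreadVec_right_injective (hq : q ≠ 0) {v : Fin 2 → F} (hv : v ≠ 0) :
    Function.Injective (spreadVec q v) := by
  intro c d h
  have h0 := congrFun h 0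
  have h1 := congrFun h 1
  have h2 := congrFun h 2
  have h3 := congrFun h 3
  simp [spreadVec, hq] at h0 h1 h2 h3
  rw [ne_zero_fin_two_iff] at hv
  ext i
  fin_cases i
  · change c 0 = d 0
    tauto
  · change c 1 = d 1
    tauto

/-- The lines `⟨(v₀, v₁, 0, 0), (0, 0, v₀ᑫ, v₁ᑫ)⟩` are pairwise disjoint. -/
lemma exists_smul_eq_of_spreadVec_eq (hF : ∀ x : F, (x ^ q) ^ q = x)
    {v w c d : Fin 2 → F} (hc : c ≠ 0) (h : spreadVec q v c = spreadVec q w d) :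
    ∃ t : F, t • w = v := by
  have h0 := congrFun h 0
  have h1 := congrFun h 1
  have h2 := congrFun h 2
  have h3 := congrFun h 3
  simp only [spreadVec, Matrix.cons_val] at h0 h1 h2 h3
  rcases ne_zero_fin_two_iff.1 hc with hc | hc
  · refine ⟨d 0 / c 0, ?_⟩
    ext i
    fin_cases i
    · simp; field_simp; exact h0.symm
    · simp; field_simp; exact h1.symm
  · refine ⟨(d 1 / c 1) ^ q, ?_⟩
    have key {x y : F} (h : c 1 * x ^ q = d 1 * y ^ q) : (d 1 / c 1) ^ q * y = x := by
      have : d 1 / c 1 * y ^ q = x ^ q := by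
        rw [div_mul_eq_mul_div, ← h, mul_div_cancel_left₀ _ hc]
      rw [← hF x, ← this, mul_pow, hF y]
    ext i
    fin_cases i
    · exact key h2
    · exact key h3

end SpreadVec

section Points

variable {F : Type} [Field F] {q : ℕ}

lemma mk_mem_rLine_iff (hq : q ≠ 0) {P : Pt F} (hP : P ∈ t1 F) {u : Fin 4 → F} (hu : u ≠ 0) :
    Projectivization.mk F u hu ∈ rLine q F P ↔
      ∃ c, spreadVec q ![P.rep 0, P.rep 1] c = u := by
  obtain ⟨h2, h3⟩ := hP
  have hne : tauFun q F 1 P.rep ≠ 0 := by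
    intro h
    refine P.rep_nonzero ?_
    have e2 := congrFun h 2
    have e3 := congrFun h 3
    simp [tauFun, hq] at e2 e3
    ext i
    fin_cases i <;> assumption
  have hcomb (a b : F) : a • P.rep + b • tauFun q F 1 P.rep
      = spreadVec q ![P.rep 0, P.rep 1] ![a, b] := by
    ext i
    fin_cases i <;> simp [spreadVec, tauFun, h2, h3, hq]
  simp only [rLine, lineThrough, tau, dif_pos hne, Set.mem_ofPred_eq, submodule_mk,
    submodule_eq P, Submodule.span_singleton_le_iff_mem, ← Submodule.span_union,
    Set.singleton_union, Submodule.mem_span_pair, hcomb]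
  constructor
  · rintro ⟨a, b, h⟩
    exact ⟨_, h⟩
  · rintro ⟨c, h⟩
    exact ⟨c 0, c 1, by rw [← h]; congr 1; ext i; fin_cases i <;> rfl⟩

/-- The point of `r_P` with parameter `R`, for `P` and `R` points of a projective line. -/
noncomputable def spreadPoint (hq : q ≠ 0)
    (x : Projectivization F (Fin 2 → F) × Projectivization F (Fin 2 → F)) : Pt F :=
  Projectivization.mk F (spreadVec q x.1.rep x.2.rep)
    ((spreadVec_ne_zero_iff hq).2 ⟨x.1.rep_nonzero, x.2.rep_nonzero⟩)

lemma spreadPoint_injective (hq : q ≠ 0) (hF : ∀ x : F, (x ^ q) ^ q = x) :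
    Function.Injective (spreadPoint (F := F) hq) := by
  rintro ⟨P, R⟩ ⟨P', R'⟩ h
  obtain ⟨s, hs⟩ := (mk_eq_mk_iff' F _ _ _ _).1 h
  dsimp only at hs
  rw [← spreadVec_smul_right] at hs
  have hP : P = P' := by
    obtain ⟨t, ht⟩ := exists_smul_eq_of_spreadVec_eq hF R.rep_nonzero hs.symm
    rw [← P.mk_rep, ← P'.mk_rep]
    exact (mk_eq_mk_iff' F _ _ _ _).2 ⟨t, ht⟩
  subst hP
  have hR : R = R' := by
    rw [← R.mk_rep, ← R'.mk_rep]
    exact (mk_eq_mk_iff' F _ _ _ _).2 ⟨s, spreadVec_right_injective hq P.rep_nonzero hs⟩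
  rw [hR]

lemma mk_spreadVec_mem_range (hq : q ≠ 0) {v c : Fin 2 → F} (h : spreadVec q v c ≠ 0) :
    Projectivization.mk F (spreadVec q v c) h ∈ Set.range (spreadPoint (F := F) hq) := by
  have hv := ((spreadVec_ne_zero_iff hq).1 h).1
  obtain ⟨t, ht⟩ := (mk_eq_mk_iff' F _ _ hv (mk F v hv).rep_nonzero).1 (mk_rep _).symm
  have e : spreadVec q v c = spreadVec q (mk F v hv).rep ![c 0 * t, c 1 * t ^ q] := by
    rw [← spreadVec_smul_left, ht]
  have hd : ![c 0 * t, c 1 * t ^ q] ≠ 0 := ((spreadVec_ne_zero_iff hq).1 (e ▸ h)).2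
  obtain ⟨s, hs⟩ := (mk_eq_mk_iff' F _ _ (mk F _ hd).rep_nonzero hd).1 (mk_rep _)
  refine ⟨(mk F v hv, mk F _ hd), (mk_eq_mk_iff' F _ _ _ _).2 ⟨s, ?_⟩⟩
  rw [e, ← spreadVec_smul_right, hs]

lemma iUnion_rLine_eq_range (hq : q ≠ 0) :
    ⋃ P ∈ t1 F, rLine q F P = Set.range (spreadPoint (F := F) hq) := by
  ext Q
  simp only [Set.mem_iUnion, exists_prop]
  constructor
  · rintro ⟨P, hP, hQ⟩
    rw [← Q.mk_rep, mk_mem_rLine_iff hq hP] at hQ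
    obtain ⟨c, hc⟩ := hQ
    have := mk_spreadVec_mem_range hq (hc ▸ Q.rep_nonzero)
    simpa only [hc, mk_rep] using this
  · rintro ⟨⟨P, R⟩, rfl⟩
    have hne : ![P.rep 0, P.rep 1, 0, 0] ≠ 0 := by
      intro h
      rcases ne_zero_fin_two_iff.1 P.rep_nonzero with h' | h'
      · exact h' (congrFun h 0)
      · exact h' (congrFun h 1)
    obtain ⟨t, ht⟩ := (mk_eq_mk_iff' F _ _ hne (mk F _ hne).rep_nonzero).1 (mk_rep _).symm
    have ht0 : t ≠ 0 := by
      rintro rfl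
      exact hne (by rw [← ht, zero_smul])
    have hcoord (i : Fin 4) := congrFun ht i
    have hmem : mk F _ hne ∈ t1 F := by
      constructor
      · simpa [ht0] using hcoord 2
      · simpa [ht0] using hcoord 3
    refine ⟨mk F _ hne, hmem, ?_⟩
    have hrep : P.rep = t • ![(mk F _ hne).rep 0, (mk F _ hne).rep 1] := by
      ext i
      fin_cases i
      · exact (hcoord 0).symm
      · exact (hcoord 1).symm
    rw [spreadPoint, mk_mem_rLine_iff hq hmem]
    exact ⟨_, by rw [← spreadVec_smul_left, ← hrep]⟩

end Points

/-- The union `D̄ = ⋃_{P ∈ t₁} r_P` has exactly `(q²+1)²` points. -/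
theorem statement4 (q : ℕ) (hq : IsPrimePow q) (F : Type) [Field F] [Fintype F]
    (hF : Fintype.card F = q ^ 2) :
    (⋃ P ∈ t1 F, rLine q F P).ncard = (q ^ 2 + 1) ^ 2 := by
  have hq0 : q ≠ 0 := hq.ne_zero
  have hpow (x : F) : (x ^ q) ^ q = x := by
    rw [← pow_mul, ← sq, ← hF, FiniteField.pow_card]
  rw [iUnion_rLine_eq_range hq0, ← Nat.card_coe_set_eq,
    Nat.card_range_of_injective (spreadPoint_injective hq0 hpow), Nat.card_prod,
    card_of_finrank_two F (Fin 2 → F) (by simp), Nat.card_eq_fintype_card, hF, sq (q ^ 2 + 1)]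
end

section
/- Let q be a prime power and let D̄ := ⋃_{P ∈ t_1} r_P. For every plane π of PG(3,q^2), the number of points of π ∩ D̄ is either q^2+1 or 2q^2+1. Moreover, if |π ∩ D̄| = 2q^2+1, then there exists a point P of t_1 with r_P ⊆ π, and either π ∩ D̄ = r_P ∪ t_1 (with t_1 ⊆ π), or π ∩ D̄ = r_P ∪ t_2 (with t_2 ⊆ π), or there exists α ∈ F_{q^2} \ {0} such that π ∩ Σ_α has exactly q^2+q+1 points and π ∩ D̄ = r_P ∪ (π ∩ Σ_α). -/
open Projectivization Classical

section TwistedForm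

variable {F : Type} [Field F] {q : ℕ}

lemma exists_eq_mk (P : Pt F) : ∃ (v : Fin 4 → F) (hv : v ≠ 0), P = Projectivization.mk F v hv :=
  ⟨P.rep, P.rep_nonzero, P.mk_rep.symm⟩

lemma exists_mk_rep_eq_smul {n : ℕ} (v : Fin n → F) (hv : v ≠ 0) :
    ∃ k : F, k ≠ 0 ∧ (Projectivization.mk F v hv).rep = k • v := by
  obtain ⟨a, ha⟩ := Projectivization.exists_smul_eq_mk_rep F v hv
  exact ⟨a, a.ne_zero, ha.symm⟩

lemma mk_submodule_le_iff (v : Fin 4 → F) (hv : v ≠ 0) (W : Submodule F (Fin 4 → F)) :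
    (Projectivization.mk F v hv).submodule ≤ W ↔ v ∈ W := by
  rw [Projectivization.submodule_mk, Submodule.span_singleton_le_iff_mem]

lemma mk_mem_t1_iff (v : Fin 4 → F) (hv : v ≠ 0) :
    Projectivization.mk F v hv ∈ t1 F ↔ v 2 = 0 ∧ v 3 = 0 := by
  obtain ⟨k, hk, h⟩ := exists_mk_rep_eq_smul v hv
  simp [t1, h, hk]

lemma mk_mem_t2_iff (v : Fin 4 → F) (hv : v ≠ 0) :
    Projectivization.mk F v hv ∈ t2 F ↔ v 0 = 0 ∧ v 1 = 0 := by
  obtain ⟨k, hk, h⟩ := exists_mk_rep_eq_smul v hv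
  simp [t2, h, hk]

/-- The point `(a, b, 0, 0)` of `t₁`. -/
noncomputable def t1Point (a b : F) (h : a ≠ 0 ∨ b ≠ 0) : Pt F :=
  Projectivization.mk F ![a, b, 0, 0] (by
    intro h0
    have h1 := congrFun h0 0
    have h2 := congrFun h0 1
    simp_all)

lemma t1Point_mem (a b : F) (h : a ≠ 0 ∨ b ≠ 0) : t1Point a b h ∈ t1 F := by
  simp [t1Point, mk_mem_t1_iff]

lemma exists_eq_t1Point {P : Pt F} (hP : P ∈ t1 F) : ∃ a b h, P = t1Point a b h := by
  obtain ⟨v, hv, rfl⟩ := exists_eq_mk P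
  rw [mk_mem_t1_iff] at hP
  have e : v = ![v 0, v 1, 0, 0] := by
    ext i; fin_cases i <;> simp [hP]
  refine ⟨v 0, v 1, ?_, ?_⟩
  · by_contra! h
    apply hv
    rw [e]
    ext i; fin_cases i <;> simp [h]
  · unfold t1Point
    congr 1

lemma mk_mem_rLine_iff_s5 (hq : q ≠ 0) (a b : F) (h : a ≠ 0 ∨ b ≠ 0) (v : Fin 4 → F) (hv : v ≠ 0) :
    Projectivization.mk F v hv ∈ rLine q F (t1Point a b h) ↔
      ∃ s t : F, v = ![s * a, s * b, t * a ^ q, t * b ^ q] := by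
  obtain ⟨k, hk, hr⟩ : ∃ k : F, k ≠ 0 ∧ (t1Point a b h).rep = k • ![a, b, 0, 0] :=
    exists_mk_rep_eq_smul _ _
  have ht : tauFun q F 1 (t1Point a b h).rep = k ^ q • ![0, 0, a ^ q, b ^ q] := by
    ext i; fin_cases i <;> simp [tauFun, hr, hq, mul_pow]
  have hw : (![0, 0, a ^ q, b ^ q] : Fin 4 → F) ≠ 0 := by
    intro h0
    have h1 := congrFun h0 2
    have h2 := congrFun h0 3
    simp at h1 h2
    grind
  have hkq : k ^ q ≠ 0 := pow_ne_zero _ hk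
  have hsub : (tau q F 1 (t1Point a b h)).submodule = F ∙ ![0, 0, a ^ q, b ^ q] := by
    have h0 : tauFun q F 1 (t1Point a b h).rep ≠ 0 := by
      rw [ht]; exact smul_ne_zero hkq hw
    rw [tau, dif_pos h0, Projectivization.submodule_mk, ht,
      Submodule.span_singleton_smul_eq (IsUnit.mk0 _ hkq)]
  rw [rLine, lineThrough, Set.mem_ofPred_eq, mk_submodule_le_iff, hsub, t1Point,
    Projectivization.submodule_mk, ← Submodule.span_insert, Submodule.mem_span_pair]
  refine exists₂_congr fun s t => ?_
  rw [eq_comm]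
  simp

/-- Every point of `⋃_{P ∈ t₁} r_P` has coordinates `(s a, s b, t aᑫ, t bᑫ)` with
`(a, b) ≠ (0, 0)`. -/
lemma mk_mem_iUnion_rLine_iff (hq : q ≠ 0) (v : Fin 4 → F) (hv : v ≠ 0) :
    Projectivization.mk F v hv ∈ (⋃ P ∈ t1 F, rLine q F P) ↔
      ∃ a b s t : F, (a ≠ 0 ∨ b ≠ 0) ∧ v = ![s * a, s * b, t * a ^ q, t * b ^ q] := by
  simp only [Set.mem_iUnion]
  constructor
  · rintro ⟨P, hP, hv'⟩
    obtain ⟨a, b, h, rfl⟩ := exists_eq_t1Point hP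
    obtain ⟨s, t, e⟩ := (mk_mem_rLine_iff_s5 hq a b h v hv).1 hv'
    exact ⟨a, b, s, t, h, e⟩
  · rintro ⟨a, b, s, t, h, e⟩
    exact ⟨_, t1Point_mem a b h, (mk_mem_rLine_iff_s5 hq a b h v hv).2 ⟨s, t, e⟩⟩

lemma isPlane.exists_equation {π : Set (Pt F)} (hπ : isPlane F π) :
    ∃ c : Fin 4 → F, c ≠ 0 ∧ ∀ v hv, Projectivization.mk F v hv ∈ π ↔
      v 0 * c 0 + v 1 * c 1 + v 2 * c 2 + v 3 * c 3 = 0 := by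
  obtain ⟨W, hW, rfl⟩ := hπ
  have hlt : W < ⊤ := by
    rw [lt_top_iff_ne_top]
    rintro rfl
    simp at hW
  obtain ⟨f, hf, hle⟩ := W.exists_le_ker_of_lt_top hlt
  have hker : W = LinearMap.ker f := by
    refine Submodule.eq_of_le_of_finrank_le hle ?_
    have h1 := Module.Dual.finrank_ker_add_one_of_ne_zero hf
    simp at h1
    lia
  let c : Fin 4 → F := fun i => f fun j => if i = j then 1 else 0
  have hfv : ∀ v, f v = v 0 * c 0 + v 1 * c 1 + v 2 * c 2 + v 3 * c 3 := by
    intro v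
    rw [LinearMap.pi_apply_eq_sum_univ f v, Fin.sum_univ_four]
    simp only [smul_eq_mul, c]
  refine ⟨c, ?_, fun v hv => ?_⟩
  · intro h
    refine hf (LinearMap.ext fun v => ?_)
    simp [hfv, h]
  · rw [Set.mem_ofPred_eq, mk_submodule_le_iff, hker, LinearMap.mem_ker, hfv]

lemma rep_ne_zero_or (ℓ : Projectivization F (Fin 2 → F)) : ℓ.rep 0 ≠ 0 ∨ ℓ.rep 1 ≠ 0 := by
  by_contra! h
  apply ℓ.rep_nonzero
  ext i; fin_cases i <;> simp [h]

lemma projLine_eq_iff (ℓ m : Projectivization F (Fin 2 → F)) :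
    ℓ = m ↔ ℓ.rep 0 * m.rep 1 = ℓ.rep 1 * m.rep 0 := by
  constructor
  · rintro rfl; ring
  · intro h
    rw [← ℓ.mk_rep, ← m.mk_rep, Projectivization.mk_eq_mk_iff']
    rcases rep_ne_zero_or m with h0 | h0
    · refine ⟨ℓ.rep 0 / m.rep 0, ?_⟩
      ext i; fin_cases i <;> simp <;> grind
    · refine ⟨ℓ.rep 1 / m.rep 1, ?_⟩
      ext i; fin_cases i <;> simp <;> grind

/-- The vector of the point with coordinates `m` on the line `r_P`, where `P` has coordinates
`ℓ`. -/
noncomputable def ruledVec (q : ℕ) (ℓ m : Projectivization F (Fin 2 → F)) : Fin 4 → F :=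
  ![m.rep 0 * ℓ.rep 0, m.rep 0 * ℓ.rep 1, m.rep 1 * ℓ.rep 0 ^ q, m.rep 1 * ℓ.rep 1 ^ q]

lemma ruledVec_ne_zero (ℓ m : Projectivization F (Fin 2 → F)) : ruledVec q ℓ m ≠ 0 := by
  intro h
  have h0 := congrFun h 0
  have h1 := congrFun h 1
  have h2 := congrFun h 2
  have h3 := congrFun h 3
  simp [ruledVec] at h0 h1 h2 h3
  have := rep_ne_zero_or ℓ
  have := rep_ne_zero_or m
  grind

/-- The point with coordinates `m` on the line `r_P`, where `P` has coordinates `ℓ`. -/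
noncomputable def ruledPoint (q : ℕ) (p : Projectivization F (Fin 2 → F) × Projectivization F (Fin 2 → F)) :
    Pt F :=
  Projectivization.mk F (ruledVec q p.1 p.2) (ruledVec_ne_zero p.1 p.2)

lemma ruledPoint_injective (hinj : Function.Injective fun x : F => x ^ q) :
    Function.Injective (ruledPoint (F := F) q) := by
  rintro ⟨ℓ, m⟩ ⟨ℓ', m'⟩ h
  rw [ruledPoint, ruledPoint, Projectivization.mk_eq_mk_iff'] at h
  obtain ⟨k, hk⟩ := h
  have h0 := congrFun hk 0
  have h1 := congrFun hk 1
  have h2 := congrFun hk 2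
  have h3 := congrFun hk 3
  simp [ruledVec] at h0 h1 h2 h3
  have e : ℓ = ℓ' := by
    rw [projLine_eq_iff]
    rcases rep_ne_zero_or m with hm | hm
    · refine mul_left_cancel₀ hm ?_
      linear_combination ℓ'.rep 0 * h1 - ℓ'.rep 1 * h0
    · apply hinj
      simp only [mul_pow]
      refine mul_left_cancel₀ hm ?_
      linear_combination ℓ'.rep 0 ^ q * h3 - ℓ'.rep 1 ^ q * h2
  subst e
  refine Prod.ext rfl ?_
  change m = m'
  rw [projLine_eq_iff]
  rcases rep_ne_zero_or ℓ with hl | hl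
  · have hl' := pow_ne_zero q hl
    have e0 : k * m'.rep 0 = m.rep 0 := mul_right_cancel₀ hl (by linear_combination h0)
    have e1 : k * m'.rep 1 = m.rep 1 := mul_right_cancel₀ hl' (by linear_combination h2)
    rw [← e0, ← e1]; ring
  · have hl' := pow_ne_zero q hl
    have e0 : k * m'.rep 0 = m.rep 0 := mul_right_cancel₀ hl (by linear_combination h1)
    have e1 : k * m'.rep 1 = m.rep 1 := mul_right_cancel₀ hl' (by linear_combination h3)
    rw [← e0, ← e1]; ring

lemma rLine_eq_range (hq : q ≠ 0) (ℓ : Projectivization F (Fin 2 → F)) :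
    rLine q F (t1Point (ℓ.rep 0) (ℓ.rep 1) (rep_ne_zero_or ℓ)) =
      Set.range fun m => ruledPoint q (ℓ, m) := by
  ext Q
  obtain ⟨v, hv, rfl⟩ := exists_eq_mk Q
  rw [mk_mem_rLine_iff_s5 hq]
  constructor
  · rintro ⟨s, t, rfl⟩
    have hst : (![s, t] : Fin 2 → F) ≠ 0 := by
      intro h
      have h0 := congrFun h 0
      have h1 := congrFun h 1
      simp at h0 h1
      apply hv
      ext i; fin_cases i <;> simp [h0, h1]
    obtain ⟨k, hk, hr⟩ := exists_mk_rep_eq_smul _ hst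
    refine ⟨Projectivization.mk F _ hst, ?_⟩
    dsimp only [ruledPoint]
    rw [Projectivization.mk_eq_mk_iff']
    refine ⟨k, ?_⟩
    ext i; fin_cases i <;> simp [ruledVec, hr] <;> ring
  · rintro ⟨m, hm⟩
    dsimp only [ruledPoint] at hm
    rw [eq_comm, Projectivization.mk_eq_mk_iff'] at hm
    obtain ⟨k, rfl⟩ := hm
    refine ⟨k * m.rep 0, k * m.rep 1, ?_⟩
    ext i; fin_cases i <;> simp [ruledVec] <;> ring

lemma range_ruledPoint (hq : q ≠ 0) :
    Set.range (ruledPoint (F := F) q) = ⋃ P ∈ t1 F, rLine q F P := by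
  ext Q
  constructor
  · rintro ⟨⟨ℓ, m⟩, rfl⟩
    simp only [Set.mem_iUnion]
    exact ⟨_, t1Point_mem _ _ (rep_ne_zero_or ℓ), by rw [rLine_eq_range hq]; exact ⟨m, rfl⟩⟩
  · obtain ⟨v, hv, rfl⟩ := exists_eq_mk Q
    rw [mk_mem_iUnion_rLine_iff hq]
    rintro ⟨a, b, s, t, h, e⟩
    have hab : (![a, b] : Fin 2 → F) ≠ 0 := by
      intro h'
      have h0 := congrFun h' 0
      have h1 := congrFun h' 1
      simp_all
    obtain ⟨k, hk, hr⟩ := exists_mk_rep_eq_smul _ hab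
    have hmem : Projectivization.mk F v hv ∈ rLine q F (t1Point _ _
        (rep_ne_zero_or (Projectivization.mk F _ hab))) := by
      rw [mk_mem_rLine_iff_s5 hq]
      refine ⟨s / k, t / k ^ q, ?_⟩
      rw [e]
      ext i; fin_cases i <;> simp [hr, mul_pow] <;> field_simp
    rw [rLine_eq_range hq] at hmem
    obtain ⟨m, hm⟩ := hmem
    exact ⟨_, hm⟩

lemma card_projLine [Fintype F] :
    Nat.card (Projectivization F (Fin 2 → F)) = Fintype.card F + 1 := by
  rw [Projectivization.card_of_finrank_two F _ (by simp), Nat.card_eq_fintype_card]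

lemma ncard_rLine [Fintype F] (hq : q ≠ 0) (hinj : Function.Injective fun x : F => x ^ q)
    (ℓ : Projectivization F (Fin 2 → F)) :
    (rLine q F (t1Point (ℓ.rep 0) (ℓ.rep 1) (rep_ne_zero_or ℓ))).ncard = Fintype.card F + 1 := by
  rw [rLine_eq_range hq, ← Set.image_univ, Set.ncard_image_of_injective, Set.ncard_univ,
    card_projLine]
  exact (ruledPoint_injective hinj).comp (Prod.mk_right_injective ℓ)

lemma ncard_linearForm_zeros [Fintype F] (A B : F) :
    {m : Projectivization F (Fin 2 → F) | m.rep 0 * A + m.rep 1 * B = 0}.ncard =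
      if A = 0 ∧ B = 0 then Fintype.card F + 1 else 1 := by
  split_ifs with h
  · simp [h, Set.ncard_univ, card_projLine]
  · have hBA : (![B, -A] : Fin 2 → F) ≠ 0 := by
      intro h'
      have h0 := congrFun h' 0
      have h1 := congrFun h' 1
      simp_all
    obtain ⟨k, hk, hr⟩ := exists_mk_rep_eq_smul _ hBA
    rw [Set.ncard_eq_one]
    refine ⟨Projectivization.mk F _ hBA, ?_⟩
    ext m
    rw [Set.mem_singleton_iff, projLine_eq_iff, hr, Set.mem_ofPred_eq]
    simp
    grind

lemma ncard_plane_inter [Fintype F] (hq : q ≠ 0) (hinj : Function.Injective fun x : F => x ^ q)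
    {π : Set (Pt F)} {c : Fin 4 → F}
    (hπ : ∀ v hv, Projectivization.mk F v hv ∈ π ↔
      v 0 * c 0 + v 1 * c 1 + v 2 * c 2 + v 3 * c 3 = 0)
    [Fintype (Projectivization F (Fin 2 → F))] :
    (π ∩ ⋃ P ∈ t1 F, rLine q F P).ncard =
      ∑ ℓ : Projectivization F (Fin 2 → F),
        if ℓ.rep 0 * c 0 + ℓ.rep 1 * c 1 = 0 ∧ ℓ.rep 0 ^ q * c 2 + ℓ.rep 1 ^ q * c 3 = 0
        then Fintype.card F + 1 else 1 := by
  rw [← range_ruledPoint hq, ← Set.image_preimage_eq_inter_range,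
    Set.ncard_image_of_injective _ (ruledPoint_injective hinj), ← Nat.card_coe_set_eq]
  simp_rw [← ncard_linearForm_zeros, ← Nat.card_coe_set_eq]
  rw [← Nat.card_sigma]
  refine Nat.card_congr
    { toFun := fun p => ⟨p.1.1, p.1.2, ?_⟩
      invFun := fun p => ⟨(p.1, p.2.1), ?_⟩
      left_inv := fun _ => rfl
      right_inv := fun _ => rfl }
  · have := p.2
    rw [Set.mem_preimage, ruledPoint, hπ] at this
    simp [ruledVec] at this
    simp only [Set.mem_ofPred_eq]
    linear_combination this
  · have := p.2.2
    rw [Set.mem_ofPred_eq] at this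
    rw [Set.mem_preimage, ruledPoint, hπ]
    simp [ruledVec]
    linear_combination this

lemma ncard_rLine_inter_sigma [Fintype F] (hF : Fintype.card F = q ^ 2) (hq : 1 < q)
    (a b : F) (h : a ≠ 0 ∨ b ≠ 0) {α : F} (hα : α ≠ 0) :
    (rLine q F (t1Point a b h) ∩ SigmaSet q F α).ncard = q + 1 := by
  have hne : ∀ u : F, ![a, b, α * u * a ^ q, α * u * b ^ q] ≠ 0 := by
    intro u h'
    have h0 := congrFun h' 0
    have h1 := congrFun h' 1
    simp_all
  have hpow : ∀ k : F, k ^ q = k ^ (q - 1) * k := fun k => by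
    rw [← pow_succ, Nat.sub_add_cancel hq.le]
  set f : Fˣ → Pt F := fun u => Projectivization.mk F _ (hne u) with hf
  have hset : rLine q F (t1Point a b h) ∩ SigmaSet q F α =
      f '' ((powMonoidHom (q - 1) : Fˣ →* Fˣ).range : Set Fˣ) := by
    ext Q
    constructor
    · rintro ⟨hr, x, y, hxy, rfl⟩
      rw [mk_mem_rLine_iff_s5 (by lia)] at hr
      obtain ⟨s, t, e⟩ := hr
      have h0 := congrFun e 0
      have h1 := congrFun e 1
      simp at h0 h1
      have hs : s ≠ 0 := by
        rintro rfl
        apply hxy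
        ext i; fin_cases i <;> simp [h0, h1] <;> lia
      refine ⟨_, ⟨Units.mk0 s hs, rfl⟩, ?_⟩
      rw [hf]
      dsimp only
      rw [Projectivization.mk_eq_mk_iff']
      refine ⟨s⁻¹, ?_⟩
      ext i
      fin_cases i <;> simp [h0, h1, mul_pow, hpow s] <;> field_simp
    · rintro ⟨_, ⟨k, rfl⟩, rfl⟩
      constructor
      · rw [hf]
        dsimp only
        rw [mk_mem_rLine_iff_s5 (by lia)]
        exact ⟨1, α * ((k ^ (q - 1) : Fˣ) : F), by simp⟩
      · have hk : (k : F) ≠ 0 := k.ne_zero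
        refine ⟨k * a, k * b, ?_, ?_⟩
        · intro h'
          have h0 := congrFun h' 0
          have h1 := congrFun h' 1
          simp_all
        · rw [hf]
          dsimp only
          rw [Projectivization.mk_eq_mk_iff']
          refine ⟨(k : F)⁻¹, ?_⟩
          ext i
          fin_cases i <;> simp [mul_pow, hpow (k : F)] <;> field_simp
  have hfinj : Function.Injective f := by
    intro u w huw
    rw [hf] at huw
    dsimp only at huw
    rw [Projectivization.mk_eq_mk_iff'] at huw
    obtain ⟨k, hk⟩ := huw
    have h0 := congrFun hk 0
    have h1 := congrFun hk 1
    have h2 := congrFun hk 2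
    have h3 := congrFun hk 3
    simp at h0 h1 h2 h3
    have hk1 : k = 1 := by grind
    subst hk1
    ext
    rcases h with h | h
    · have := pow_ne_zero q h
      grind
    · have := pow_ne_zero q h
      grind
  rw [hset, Set.ncard_image_of_injective _ hfinj, ← Nat.card_coe_set_eq]
  change Nat.card (powMonoidHom (q - 1) : Fˣ →* Fˣ).range = q + 1
  have hcard : Nat.card Fˣ = (q + 1) * (q - 1) := by
    rw [Nat.card_units, Nat.card_eq_fintype_card, hF, ← Nat.sq_sub_sq, one_pow]
  rw [IsCyclic.card_powMonoidHom_range, hcard, Nat.gcd_mul_left_left,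
    Nat.mul_div_cancel _ (by lia)]

lemma exists_eq_mul_of_orthogonal {a b c d : F} (h : a ≠ 0 ∨ b ≠ 0) (hc : a * c + b * d = 0) :
    ∃ μ : F, c = μ * b ∧ d = -(μ * a) := by
  rcases h with h | h
  · exact ⟨-(d / a), by grind, by grind⟩
  · exact ⟨c / b, by grind, by grind⟩

lemma sigmaSet_subset_iUnion_rLine (hq : q ≠ 0) (α : F) :
    SigmaSet q F α ⊆ ⋃ P ∈ t1 F, rLine q F P := by
  rintro _ ⟨x, y, hxy, rfl⟩
  rw [mk_mem_iUnion_rLine_iff hq]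
  refine ⟨x, y, 1, α, ?_, by simp⟩
  by_contra! h
  apply hxy
  ext i; fin_cases i <;> simp [h, hq]

lemma sub_pow_of_card_eq_sq [Fintype F] (hq : IsPrimePow q) (hF : Fintype.card F = q ^ 2)
    (x y : F) : (x - y) ^ q = x ^ q - y ^ q := by
  obtain ⟨p, n, hp, hn, rfl⟩ := hq
  have : Fact p.Prime := ⟨hp.nat_prime⟩
  have : CharP F p := charP_of_card_eq_prime_pow (f := n * 2) (by rw [hF, pow_mul])
  exact sub_pow_char_pow x y n

lemma pow_injective_of_card_eq_sq [Fintype F] (hF : Fintype.card F = q ^ 2) :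
    Function.Injective fun x : F => x ^ q := by
  have h : ∀ x : F, (x ^ q) ^ q = x := fun x => by
    rw [← pow_mul, ← sq, ← hF, FiniteField.pow_card]
  intro x y hxy
  rw [← h x, ← h y]
  exact congrArg (· ^ q) hxy

lemma rLine_subset_iUnion {P : Pt F} (hP : P ∈ t1 F) :
    rLine q F P ⊆ ⋃ P' ∈ t1 F, rLine q F P' :=
  Set.subset_biUnion_of_mem (u := fun P => rLine q F P) hP

lemma t1_subset_iUnion_rLine (hq : q ≠ 0) : t1 F ⊆ ⋃ P ∈ t1 F, rLine q F P := by
  intro Q hQ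
  obtain ⟨a, b, h, rfl⟩ := exists_eq_t1Point hQ
  rw [t1Point, mk_mem_iUnion_rLine_iff hq]
  exact ⟨a, b, 1, 0, h, by simp⟩

lemma t2_subset_iUnion_rLine (hq : q ≠ 0) (hsurj : Function.Surjective fun x : F => x ^ q) :
    t2 F ⊆ ⋃ P ∈ t1 F, rLine q F P := by
  intro Q hQ
  obtain ⟨v, hv, rfl⟩ := exists_eq_mk Q
  rw [mk_mem_t2_iff] at hQ
  rw [mk_mem_iUnion_rLine_iff hq]
  obtain ⟨a, ha⟩ := hsurj (v 2)
  obtain ⟨b, hb⟩ := hsurj (v 3)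
  dsimp only at ha hb
  refine ⟨a, b, 0, 1, ?_, ?_⟩
  · by_contra! h
    apply hv
    ext i; fin_cases i <;> simp [hQ, ← ha, ← hb, h, hq]
  · ext i; fin_cases i <;> simp [hQ, ha, hb]

lemma rLine_subset_plane {a b μ ν : F} {π : Set (Pt F)} (h : a ≠ 0 ∨ b ≠ 0)
    (hπ : ∀ v hv, Projectivization.mk F v hv ∈ π ↔
      μ * (b * v 0 - a * v 1) + ν * (b ^ q * v 2 - a ^ q * v 3) = 0)
    (hq : q ≠ 0) : rLine q F (t1Point a b h) ⊆ π := by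
  intro Q hQ
  obtain ⟨v, hv, rfl⟩ := exists_eq_mk Q
  obtain ⟨s, t, rfl⟩ := (mk_mem_rLine_iff_s5 hq _ _ _ _ _).1 hQ
  rw [hπ]
  simp
  ring

/-- A point of the plane lying on some `r_{P'}` but not on `r_P`, where `P = (a, b, 0, 0)`, has
coordinates `(s x, s y, t xᑫ, t yᑫ)` with `b x ≠ a y`, subject to a reduced plane equation. -/
lemma exists_coords_of_notMem_rLine {a b μ ν : F} {π : Set (Pt F)} (h : a ≠ 0 ∨ b ≠ 0)
    (hπ : ∀ v hv, Projectivization.mk F v hv ∈ π ↔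
      μ * (b * v 0 - a * v 1) + ν * (b ^ q * v 2 - a ^ q * v 3) = 0)
    (hq : q ≠ 0)
    (hsub : ∀ x y : F, (x - y) ^ q = x ^ q - y ^ q)
    {v : Fin 4 → F} {hv : v ≠ 0} (hvπ : Projectivization.mk F v hv ∈ π)
    (hvD : Projectivization.mk F v hv ∈ ⋃ P ∈ t1 F, rLine q F P)
    (hvr : Projectivization.mk F v hv ∉ rLine q F (t1Point a b h)) :
    ∃ x y s t : F, v = ![s * x, s * y, t * x ^ q, t * y ^ q] ∧ b * x - a * y ≠ 0 ∧
      s * μ + t * ν * (b * x - a * y) ^ (q - 1) = 0 := by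
  obtain ⟨x, y, s, t, hxy, rfl⟩ := (mk_mem_iUnion_rLine_iff hq _ _).1 hvD
  have hd : b * x - a * y ≠ 0 := by
    intro hd
    apply hvr
    rw [mk_mem_rLine_iff_s5 hq]
    obtain ⟨k, hx, hy⟩ : ∃ k, x = k * a ∧ y = k * b := by
      rcases h with h | h
      · exact ⟨x / a, by grind, by grind⟩
      · exact ⟨y / b, by grind, by grind⟩
    refine ⟨s * k, t * k ^ q, ?_⟩
    ext i; fin_cases i <;> simp [hx, hy, mul_pow, mul_assoc]
  refine ⟨x, y, s, t, rfl, hd, ?_⟩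
  rw [hπ] at hvπ
  simp at hvπ
  have e := hsub (b * x) (a * y)
  rw [← Nat.sub_add_cancel (Nat.one_le_iff_ne_zero.2 hq), pow_succ,
    Nat.sub_add_cancel (Nat.one_le_iff_ne_zero.2 hq), mul_pow, mul_pow] at e
  refine mul_right_cancel₀ hd ?_
  linear_combination hvπ + ν * t * e

lemma plane_inter_eq {a b μ ν : F} {π : Set (Pt F)} (h : a ≠ 0 ∨ b ≠ 0)
    (hπ : ∀ v hv, Projectivization.mk F v hv ∈ π ↔
      μ * (b * v 0 - a * v 1) + ν * (b ^ q * v 2 - a ^ q * v 3) = 0)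
    (hq : q ≠ 0) (hsub : ∀ x y : F, (x - y) ^ q = x ^ q - y ^ q)
    {T : Set (Pt F)} (hTπ : T ⊆ π) (hT : T ⊆ ⋃ P ∈ t1 F, rLine q F P)
    (hmem : ∀ x y s t hv, b * x - a * y ≠ 0 →
      s * μ + t * ν * (b * x - a * y) ^ (q - 1) = 0 →
      Projectivization.mk F ![s * x, s * y, t * x ^ q, t * y ^ q] hv ∈ T) :
    π ∩ (⋃ P ∈ t1 F, rLine q F P) = rLine q F (t1Point a b h) ∪ T := by
  apply Set.Subset.antisymm
  · rintro Q ⟨hQπ, hQD⟩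
    by_cases hQ : Q ∈ rLine q F (t1Point a b h)
    · exact Or.inl hQ
    · right
      obtain ⟨v, hv, rfl⟩ := exists_eq_mk Q
      obtain ⟨x, y, s, t, rfl, hd, e⟩ :=
        exists_coords_of_notMem_rLine h hπ hq hsub hQπ hQD hQ
      exact hmem x y s t hv hd e
  · rw [Set.union_subset_iff]
    exact ⟨Set.subset_inter (rLine_subset_plane h hπ hq) (rLine_subset_iUnion (t1Point_mem a b h)),
      Set.subset_inter hTπ hT⟩

lemma plane_inter_cases {a b μ ν : F} {π : Set (Pt F)} (h : a ≠ 0 ∨ b ≠ 0)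
    (hπ : ∀ v hv, Projectivization.mk F v hv ∈ π ↔
      μ * (b * v 0 - a * v 1) + ν * (b ^ q * v 2 - a ^ q * v 3) = 0)
    (hq : q ≠ 0) (hsub : ∀ x y : F, (x - y) ^ q = x ^ q - y ^ q)
    (hsurj : Function.Surjective fun x : F => x ^ q) (hμν : μ ≠ 0 ∨ ν ≠ 0) :
    (t1 F ⊆ π ∧ π ∩ (⋃ P ∈ t1 F, rLine q F P) = rLine q F (t1Point a b h) ∪ t1 F) ∨
    (t2 F ⊆ π ∧ π ∩ (⋃ P ∈ t1 F, rLine q F P) = rLine q F (t1Point a b h) ∪ t2 F) ∨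
    ∃ α : F, α ≠ 0 ∧ π ∩ (⋃ P ∈ t1 F, rLine q F P) =
      rLine q F (t1Point a b h) ∪ (π ∩ SigmaSet q F α) := by
  by_cases hμ : μ = 0
  · left
    have hsubset : t1 F ⊆ π := by
      intro Q hQ
      obtain ⟨v, hv, rfl⟩ := exists_eq_mk Q
      rw [mk_mem_t1_iff] at hQ
      rw [hπ]
      simp [hQ, hμ]
    refine ⟨hsubset, plane_inter_eq h hπ hq hsub hsubset (t1_subset_iUnion_rLine hq) ?_⟩
    intro x y s t hv hd e
    have : t = 0 := by
      have := pow_ne_zero (q - 1) hd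
      simp_all
    rw [mk_mem_t1_iff]
    simp [this]
  by_cases hν : ν = 0
  · right; left
    have hsubset : t2 F ⊆ π := by
      intro Q hQ
      obtain ⟨v, hv, rfl⟩ := exists_eq_mk Q
      rw [mk_mem_t2_iff] at hQ
      rw [hπ]
      simp [hQ, hν]
    refine ⟨hsubset, plane_inter_eq h hπ hq hsub hsubset (t2_subset_iUnion_rLine hq hsurj) ?_⟩
    intro x y s t hv hd e
    have : s = 0 := by simp_all
    rw [mk_mem_t2_iff]
    simp [this]
  right; right
  refine ⟨-(μ / ν), by simp [hμ, hν], ?_⟩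
  refine plane_inter_eq h hπ hq hsub Set.inter_subset_left
    (Set.inter_subset_right.trans (sigmaSet_subset_iUnion_rLine hq _)) ?_
  intro x y s t hv hd e
  constructor
  · rw [hπ]
    have e' := hsub (b * x) (a * y)
    rw [← Nat.sub_add_cancel (Nat.one_le_iff_ne_zero.2 hq), pow_succ,
      Nat.sub_add_cancel (Nat.one_le_iff_ne_zero.2 hq), mul_pow, mul_pow] at e'
    simp
    linear_combination (b * x - a * y) * e - ν * t * e'
  · set d := b * x - a * y with hd'
    have hdq : d ^ q = d ^ (q - 1) * d := by
      rw [← pow_succ, Nat.sub_add_cancel (Nat.one_le_iff_ne_zero.2 hq)]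
    have hd1 := pow_ne_zero (q - 1) hd
    have ht : t = s * -(μ / ν) / d ^ (q - 1) := by
      field_simp
      linear_combination e
    have hs : s ≠ 0 := by
      rintro rfl
      apply hv
      ext i; fin_cases i <;> simp [ht]
    have key : (s * d) • ![x / d, y / d, -(μ / ν) * (x / d) ^ q, -(μ / ν) * (y / d) ^ q] =
        ![s * x, s * y, t * x ^ q, t * y ^ q] := by
      ext i
      fin_cases i <;> simp [ht, div_pow, hdq] <;> field_simp
    refine ⟨x / d, y / d, ?_, ?_⟩
    · intro h0
      rw [h0, smul_zero] at key
      exact hv key.symm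
    · rw [Projectivization.mk_eq_mk_iff']
      exact ⟨s * d, key⟩

end TwistedForm

/-- Every plane meets `D̄ = ⋃_{P ∈ t₁} r_P` in `q²+1` or `2q²+1` points, and the structure
of the intersection in the latter case. -/
theorem statement5 (q : ℕ) (hq : IsPrimePow q) (F : Type) [Field F] [Fintype F]
    (hF : Fintype.card F = q ^ 2)
    (π : Set (Pt F)) (hπ : isPlane F π) :
    ((π ∩ (⋃ P ∈ t1 F, rLine q F P)).ncard = q ^ 2 + 1 ∨
      (π ∩ (⋃ P ∈ t1 F, rLine q F P)).ncard = 2 * q ^ 2 + 1) ∧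
    ((π ∩ (⋃ P ∈ t1 F, rLine q F P)).ncard = 2 * q ^ 2 + 1 →
      ∃ P ∈ t1 F, rLine q F P ⊆ π ∧
        ((t1 F ⊆ π ∧ π ∩ (⋃ P' ∈ t1 F, rLine q F P') = rLine q F P ∪ t1 F) ∨
         (t2 F ⊆ π ∧ π ∩ (⋃ P' ∈ t1 F, rLine q F P') = rLine q F P ∪ t2 F) ∨
         (∃ α : F, α ≠ 0 ∧ (π ∩ SigmaSet q F α).ncard = q ^ 2 + q + 1 ∧
            π ∩ (⋃ P' ∈ t1 F, rLine q F P') = rLine q F P ∪ (π ∩ SigmaSet q F α)))) := by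
  have hq1 : 1 < q := hq.one_lt
  have hq0 : q ≠ 0 := by lia
  have hinj := pow_injective_of_card_eq_sq hF
  have hsub := sub_pow_of_card_eq_sq hq hF
  have hsq : q ^ 2 ≠ 0 := pow_ne_zero _ hq0
  obtain ⟨c, hc, hcπ⟩ := hπ.exists_equation
  have : Fintype (Projectivization F (Fin 2 → F)) := Fintype.ofFinite _
  have hcard : Fintype.card (Projectivization F (Fin 2 → F)) = q ^ 2 + 1 := by
    rw [← Nat.card_eq_fintype_card, card_projLine, hF]
  have hN := ncard_plane_inter hq0 hinj hcπ
  by_cases hex : ∃ ℓ : Projectivization F (Fin 2 → F),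
      ℓ.rep 0 * c 0 + ℓ.rep 1 * c 1 = 0 ∧ ℓ.rep 0 ^ q * c 2 + ℓ.rep 1 ^ q * c 3 = 0
  · obtain ⟨ℓ₀, h1, h2⟩ := hex
    have hab := rep_ne_zero_or ℓ₀
    obtain ⟨μ, hc0, hc1⟩ := exists_eq_mul_of_orthogonal hab h1
    obtain ⟨ν, hc2, hc3⟩ := exists_eq_mul_of_orthogonal
      (hab.imp (pow_ne_zero q) (pow_ne_zero q)) h2
    have hμν : μ ≠ 0 ∨ ν ≠ 0 := by
      by_contra! h0
      apply hc
      ext i; fin_cases i <;> simp [hc0, hc1, hc2, hc3, h0]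
    have hπ' : ∀ v hv, Projectivization.mk F v hv ∈ π ↔
        μ * (ℓ₀.rep 1 * v 0 - ℓ₀.rep 0 * v 1) +
          ν * (ℓ₀.rep 1 ^ q * v 2 - ℓ₀.rep 0 ^ q * v 3) = 0 := by
      intro v hv
      rw [hcπ, hc0, hc1, hc2, hc3]
      ring_nf
    have hiff : ∀ ℓ : Projectivization F (Fin 2 → F),
        (ℓ.rep 0 * c 0 + ℓ.rep 1 * c 1 = 0 ∧ ℓ.rep 0 ^ q * c 2 + ℓ.rep 1 ^ q * c 3 = 0) ↔
          ℓ = ℓ₀ := by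
      refine fun ℓ => ⟨fun ⟨e1, e2⟩ => ?_, ?_⟩
      · rw [projLine_eq_iff]
        rcases hμν with hμ | hν
        · refine mul_left_cancel₀ hμ ?_
          rw [hc0, hc1] at e1
          linear_combination e1
        · apply hinj
          simp only [mul_pow]
          refine mul_left_cancel₀ hν ?_
          rw [hc2, hc3] at e2
          linear_combination e2
      · rintro rfl
        exact ⟨h1, h2⟩
    have hN' : (π ∩ ⋃ P ∈ t1 F, rLine q F P).ncard = 2 * q ^ 2 + 1 := by
      rw [hN]
      simp only [hiff, hF]
      have : ∀ ℓ : Projectivization F (Fin 2 → F), (if ℓ = ℓ₀ then q ^ 2 + 1 else 1) =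
          (if ℓ = ℓ₀ then q ^ 2 else 0) + 1 := fun ℓ => by split_ifs <;> rfl
      rw [Finset.sum_congr rfl fun ℓ _ => this ℓ, Finset.sum_add_distrib, Finset.sum_ite_eq']
      simp [hcard]
      ring
    refine ⟨Or.inr hN', fun _ => ⟨_, t1Point_mem _ _ hab, rLine_subset_plane hab hπ' hq0, ?_⟩⟩
    rcases plane_inter_cases hab hπ' hq0 hsub (Finite.surjective_of_injective hinj) hμν with
      h | h | ⟨α, hα, h⟩
    · exact Or.inl h
    · exact Or.inr (Or.inl h)
    · refine Or.inr (Or.inr ⟨α, hα, ?_, h⟩)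
      have hadd := Set.ncard_union_add_ncard_inter
        (rLine q F (t1Point _ _ hab)) (π ∩ SigmaSet q F α)
      rw [← h, hN', ← Set.inter_assoc,
        Set.inter_eq_self_of_subset_left (rLine_subset_plane hab hπ' hq0),
        ncard_rLine_inter_sigma hF hq1 _ _ hab hα, ncard_rLine hq0 hinj, hF] at hadd
      lia
  · push Not at hex
    have hN' : (π ∩ ⋃ P ∈ t1 F, rLine q F P).ncard = q ^ 2 + 1 := by
      rw [hN, Finset.sum_congr rfl fun ℓ _ => if_neg fun h => hex ℓ h.1 h.2]
      simp [hcard]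
    exact ⟨Or.inl hN', fun h => absurd h (by lia)⟩
end
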